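/- arXiv:1603.02929 — 7 statements merged into one kernel-verified Lean document; each statement's English description precedes it below -/
import Mathlib

section
/- Let h̄ ∈ C¹(ℝ) ∩ L¹(ℝ; e^{αx}dx) be a nonnegative solution of the stationary equation (S) satisfying the decay bound 0 < h̄(x) ≤ C·exp(−L·2^x) for all x ∈ ℝ for some constants C > 0, L > 0, and normalized so that ∫_ℝ e^{αx} h̄(x) dx = 1. Then for every s ∈ ℝ one has Σ_{k∈ℤ} e^{α(k+s)} h̄(k+s) = 1. -/
open MeasureTheory Filter

/-- The stationary equation (S): `0 = h̄′(x) + α h̄(x) + e^{-α} h̄(x-1)² - h̄(x)²`,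
for a nonnegative `C¹` function `h̄` belonging to `L¹(ℝ; e^{αx} dx)`. -/
def IsStationarySolution (α : ℝ) (hbar : ℝ → ℝ) : Prop :=
  ContDiff ℝ 1 hbar ∧ (∀ x, 0 ≤ hbar x) ∧
    Integrable (fun x => Real.exp (α * x) * hbar x) ∧
    ∀ x : ℝ, 0 = deriv hbar x + α * hbar x
      + Real.exp (-α) * (hbar (x - 1)) ^ 2 - (hbar x) ^ 2

/-- Fubini for a unit window: averaging over `[x - 1, x]` preserves the total integral. -/
theorem integral_unit_window {g : ℝ → ℝ} (hg : Integrable g) :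
    ∫ x : ℝ, ∫ t in (x - 1)..x, g t = ∫ x, g x := by
  have hind : Integrable ((Set.Ioc (0 : ℝ) 1).indicator fun _ => (1 : ℝ)) :=
    (integrable_indicator_iff measurableSet_Ioc).2
      (integrableOn_const (by simp) (by simp))
  have h := integral_convolution (ContinuousLinearMap.mul ℝ ℝ) hind hg (μ := volume) (ν := volume)
  have hconv : ∀ x : ℝ, ∫ t in (x - 1)..x, g t =
      convolution ((Set.Ioc (0 : ℝ) 1).indicator fun _ => (1 : ℝ)) g
        (ContinuousLinearMap.mul ℝ ℝ) volume x := by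
    intro x
    have hmul : ∀ t : ℝ, (Set.Ioc (0 : ℝ) 1).indicator (fun _ => (1 : ℝ)) t * g (x - t) =
        (Set.Ioc (0 : ℝ) 1).indicator (fun t => g (x - t)) t := by
      intro t
      by_cases ht : t ∈ Set.Ioc (0 : ℝ) 1 <;> simp [ht]
    simp only [convolution, ContinuousLinearMap.mul_apply', hmul]
    rw [integral_indicator measurableSet_Ioc,
      ← intervalIntegral.integral_of_le zero_le_one, intervalIntegral.integral_comp_sub_left]
    simp
  simp_rw [hconv]
  rw [h]
  simp [integral_indicator measurableSet_Ioc]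

/-- If `f` has derivative `g - g(· - 1)` and `f → 0` at `-∞`, then `f` is the unit-window integral of `g`. -/
theorem eq_unit_window_of_hasDerivAt {f g : ℝ → ℝ} (hgc : Continuous g) (hg : Integrable g)
    (hf : ∀ x, HasDerivAt f (g x - g (x - 1)) x) (hf0 : Tendsto f atBot (nhds 0)) (x : ℝ) :
    f x = ∫ t in (x - 1)..x, g t := by
  have hG : ∀ y, HasDerivAt (fun u => ∫ t in (0 : ℝ)..u, g t) (g y) y := fun y =>
    intervalIntegral.integral_hasDerivAt_right (hgc.intervalIntegrable _ _)
      (hgc.stronglyMeasurableAtFilter _ _) hgc.continuousAt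
  set G : ℝ → ℝ := fun u => ∫ t in (0 : ℝ)..u, g t with hGdef
  have hD : ∀ y, HasDerivAt (fun u => f u - (G u - G (u - 1))) 0 y := fun y => by
    have h1 := (hG (y - 1)).comp_sub_const y 1
    exact ((hf y).sub ((hG y).sub h1)).congr_deriv (sub_self _)
  have hconst := is_const_of_deriv_eq_zero (fun y => (hD y).differentiableAt)
    (fun y => (hD y).deriv)
  have hGlim : Tendsto G atBot (nhds (-∫ t in Set.Iic (0 : ℝ), g t)) := by
    have h := (intervalIntegral_tendsto_integral_Iic (0 : ℝ) hg.integrableOn tendsto_id).neg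
    refine h.congr fun u => ?_
    simp only [id, hGdef]
    rw [intervalIntegral.integral_symm, neg_neg]
  have hGlim' : Tendsto (fun u => G (u - 1)) atBot (nhds (-∫ t in Set.Iic (0 : ℝ), g t)) :=
    hGlim.comp (tendsto_atBot_add_const_right _ (-1 : ℝ) tendsto_id)
  have hlim := hf0.sub (hGlim.sub hGlim')
  have hlim' : Tendsto (fun _ : ℝ => f x - (G x - G (x - 1))) atBot (nhds 0) := by
    refine (by simpa using hlim : Tendsto (fun u => f u - (G u - G (u - 1))) atBot
      (nhds 0)).congr fun u => hconst u x
  have h0 := tendsto_nhds_unique tendsto_const_nhds hlim'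
  have hsub := intervalIntegral.integral_interval_sub_left
    (hgc.intervalIntegrable (μ := volume) 0 x) (hgc.intervalIntegrable 0 (x - 1))
  simp only [hGdef] at h0
  linarith

theorem fibre_mass_of_stationary_is_one
    (α : ℝ) (hα : 0 < α) (hbar : ℝ → ℝ)
    (hstat : IsStationarySolution α hbar)
    (hdecay : ∃ C > (0:ℝ), ∃ L > (0:ℝ),
      ∀ x : ℝ, 0 < hbar x ∧ hbar x ≤ C * Real.exp (-L * (2:ℝ) ^ x))
    (hnorm : ∫ x : ℝ, Real.exp (α * x) * hbar x = 1) :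
    ∀ s : ℝ, ∑' k : ℤ, Real.exp (α * ((k : ℝ) + s)) * hbar ((k : ℝ) + s) = 1 := by
  intro s
  obtain ⟨hC1, hnn, hint, hode⟩ := hstat
  obtain ⟨C, hC, L, hL, hdec⟩ := hdecay
  have hbd : ∀ x, hbar x ≤ C := fun x => by
    refine (hdec x).2.trans (mul_le_of_le_one_right hC.le (Real.exp_le_one_iff.2 ?_))
    have := Real.rpow_pos_of_pos (two_pos : (0 : ℝ) < 2) x
    nlinarith
  set f : ℝ → ℝ := fun x => Real.exp (α * x) * hbar x with hfdef
  set g : ℝ → ℝ := fun x => Real.exp (α * x) * hbar x * hbar x with hgdef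
  have hcont : Continuous hbar := hC1.continuous
  have hgc : Continuous g := by fun_prop
  have hg : Integrable g := hint.mul_bdd (c := C) hcont.aestronglyMeasurable
    (Eventually.of_forall fun x => by simpa [abs_of_nonneg (hnn x)] using hbd x)
  have hf : ∀ x, HasDerivAt f (g x - g (x - 1)) x := fun x => by
    have h1 := ((hasDerivAt_id x).const_mul α).exp.mul
      (hC1.differentiable one_ne_zero x).hasDerivAt
    refine h1.congr_deriv ?_
    have hexp : Real.exp (α * (x - 1)) = Real.exp (α * x) * Real.exp (-α) := by
      rw [← Real.exp_add]; ring_nf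
    simp only [hgdef, hexp, id]
    linear_combination -Real.exp (α * x) * hode x
  have hf0 : Tendsto f atBot (nhds 0) := by
    have hexp : Tendsto (fun x => Real.exp (α * x) * C) atBot (nhds 0) := by
      simpa using (Real.tendsto_exp_atBot.comp
        (tendsto_id.const_mul_atBot hα)).mul_const C
    exact squeeze_zero (fun x => mul_nonneg (Real.exp_pos _).le (hnn x))
      (fun x => mul_le_mul_of_nonneg_left (hbd x) (Real.exp_pos _).le) hexp
  have hwin := eq_unit_window_of_hasDerivAt hgc hg hf hf0
  have hmass : ∫ x, g x = 1 := by
    rw [← integral_unit_window hg]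
    refine Eq.trans ?_ hnorm
    exact integral_congr_ae (Eventually.of_forall fun x => (hwin x).symm)
  have hsum := hg.hasSum_intervalIntegral (s - 1)
  rw [hmass] at hsum
  rw [← hsum.tsum_eq]
  refine tsum_congr fun k => (hwin _).trans ?_
  congr 1 <;> ring
end

section
/- Let h̄ ∈ C¹(ℝ) ∩ L¹(ℝ; e^{αx}dx) be a nonnegative solution of the stationary equation (S) satisfying the decay bound 0 < h̄(x) ≤ C·exp(−L·2^x) for all x ∈ ℝ for some constants C > 0, L > 0, and normalized so that ∫_ℝ e^{αx} h̄(x) dx = 1. Then for every λ ∈ ℝ one has Σ_{k∈ℤ} e^{αk} h̄(k−λ) = e^{αλ}; in particular, for M > 0 the identity Σ_{k∈ℤ} e^{αk} h̄(k−λ) = M holds if and only if λ = (ln M)/α. -/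
open MeasureTheory Filter

/-- The sliding-window average of an integrable function has the same total integral. -/
lemma integral_intervalIntegral_sub_one {q : ℝ → ℝ} (hq : Integrable q) :
    ∫ x, (∫ t in (x - 1)..x, q t) = ∫ x, q x := by
  have hf : Integrable ((Set.Ioc (0 : ℝ) 1).indicator fun _ => (1 : ℝ)) :=
    (integrable_indicator_iff measurableSet_Ioc).2 (by simp [IntegrableOn])
  have h := integral_convolution (ContinuousLinearMap.mul ℝ ℝ) (μ := volume) (ν := volume) hf hq
  have hwin : ∀ x, (convolution ((Set.Ioc (0 : ℝ) 1).indicator fun _ => (1 : ℝ)) q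
      (ContinuousLinearMap.mul ℝ ℝ) volume) x = ∫ t in (x - 1)..x, q t := by
    intro x
    have hmul : ∀ t, (Set.Ioc (0 : ℝ) 1).indicator (fun _ => (1 : ℝ)) t * q (x - t)
        = (Set.Ioc (0 : ℝ) 1).indicator (fun t => q (x - t)) t := by
      intro t
      by_cases ht : t ∈ Set.Ioc (0 : ℝ) 1 <;> simp [ht]
    simp only [convolution, ContinuousLinearMap.mul_apply', hmul]
    rw [integral_indicator measurableSet_Ioc, ← intervalIntegral.integral_of_le zero_le_one,
      intervalIntegral.integral_comp_sub_left, sub_zero]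
  simp only [hwin] at h
  simpa [integral_indicator measurableSet_Ioc] using h

/-- If `g' = q - q(· - 1)` and both functions are `O(exp (α x))` at `-∞`, then `g` is the
integral of `q` over the unit window ending at `x`. -/
lemma eq_intervalIntegral_of_hasDerivAt {α A : ℝ} (hα : 0 < α) {g q : ℝ → ℝ} (hq : Continuous q)
    (hg : ∀ x, HasDerivAt g (q x - q (x - 1)) x)
    (hgb : ∀ x, ‖g x‖ ≤ A * Real.exp (α * x)) (hqb : ∀ x, ‖q x‖ ≤ A * Real.exp (α * x)) (x : ℝ) :
    g x = ∫ t in (x - 1)..x, q t := by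
  have hA : 0 ≤ A := nonneg_of_mul_nonneg_left ((norm_nonneg _).trans (hgb 0)) (Real.exp_pos _)
  set F : ℝ → ℝ := fun x => g x - ∫ t in (x - 1)..x, q t
  have hQ : ∀ x, HasDerivAt (fun x => ∫ t in (x - 1)..x, q t) (q x - q (x - 1)) x := by
    intro x
    have hP : ∀ y, HasDerivAt (fun x => ∫ t in (0 : ℝ)..x, q t) (q y) y :=
      fun y => hq.integral_hasStrictDerivAt 0 y |>.hasDerivAt
    have h := (hP x).sub ((hP (x - 1)).comp_sub_const x 1)
    refine h.congr_of_eventuallyEq (Eventually.of_forall fun y => ?_)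
    exact (intervalIntegral.integral_interval_sub_left (hq.intervalIntegrable _ _)
      (hq.intervalIntegrable _ _)).symm
  have hF' : ∀ x, HasDerivAt F 0 x := fun x =>
    ((hg x).sub (hQ x)).congr_deriv (sub_self _)
  have hconst : ∀ y, F y = F x := fun y =>
    is_const_of_deriv_eq_zero (fun z => (hF' z).differentiableAt) (fun z => (hF' z).deriv) y x
  have hbound : ∀ y, ‖F y‖ ≤ 2 * A * Real.exp (α * y) := by
    intro y
    have hint : ‖∫ t in (y - 1)..y, q t‖ ≤ A * Real.exp (α * y) * |y - (y - 1)| := by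
      refine intervalIntegral.norm_integral_le_of_norm_le_const fun t ht => (hqb t).trans ?_
      rw [Set.uIoc_of_le (by linarith)] at ht
      gcongr
      exact ht.2
    simp only [sub_sub_cancel, abs_one, mul_one] at hint
    linarith [norm_sub_le (g y) (∫ t in (y - 1)..y, q t), hgb y]
  have hlim : Tendsto (fun y => 2 * A * Real.exp (α * y)) atBot (nhds 0) := by
    simpa using (Real.tendsto_exp_atBot.comp
      (tendsto_id.const_mul_atBot hα)).const_mul (2 * A)
  have hzero : ‖F x‖ ≤ 0 :=
    ge_of_tendsto hlim (Eventually.of_forall fun y => by simpa [hconst y] using hbound y)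
  exact sub_eq_zero.1 (norm_le_zero_iff.1 hzero)

/-- The sum of the weighted profile over any translate of `ℤ` equals its total weighted mass. -/
lemma IsStationarySolution.hasSum_add_int {α C : ℝ} (hα : 0 < α) {hbar : ℝ → ℝ}
    (hstat : IsStationarySolution α hbar) (hC : ∀ x, hbar x ≤ C) (y : ℝ) :
    HasSum (fun k : ℤ => Real.exp (α * (y + k)) * hbar (y + k))
      (∫ x, Real.exp (α * x) * hbar x) := by
  obtain ⟨hsmooth, hnonneg, hint, heq⟩ := hstat
  have hC0 : 0 ≤ C := (hnonneg 0).trans (hC 0)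
  have hcont : Continuous hbar := hsmooth.continuous
  set g : ℝ → ℝ := fun x => Real.exp (α * x) * hbar x with hg
  set q : ℝ → ℝ := fun x => Real.exp (α * x) * hbar x ^ 2 with hq
  have hqc : Continuous q := by fun_prop
  have hqi : Integrable q := by
    refine (hint.mul_const C).mono' hqc.aestronglyMeasurable (Eventually.of_forall fun x => ?_)
    rw [Real.norm_of_nonneg (by positivity), hq]
    have := mul_le_mul_of_nonneg_left (hC x) (mul_nonneg (Real.exp_pos (α * x)).le (hnonneg x))
    simpa [hg, sq, mul_assoc] using this
  have hderiv : ∀ x, HasDerivAt g (q x - q (x - 1)) x := by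
    intro x
    have hh := (hsmooth.differentiable one_ne_zero x).hasDerivAt
    have he : HasDerivAt (fun x => Real.exp (α * x)) (Real.exp (α * x) * α) x := by
      simpa using ((hasDerivAt_id x).const_mul α).exp
    refine (he.mul hh).congr_deriv ?_
    have hexp : Real.exp (α * (x - 1)) = Real.exp (α * x) * Real.exp (-α) := by
      rw [← Real.exp_add]; ring_nf
    simp only [hq, hexp]
    linear_combination -Real.exp (α * x) * heq x
  have hgb : ∀ x, ‖g x‖ ≤ (C + C ^ 2) * Real.exp (α * x) := by
    intro x
    rw [Real.norm_of_nonneg (mul_nonneg (Real.exp_pos _).le (hnonneg x)), mul_comm (C + C ^ 2)]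
    exact mul_le_mul_of_nonneg_left (by nlinarith [hC x]) (Real.exp_pos _).le
  have hqb : ∀ x, ‖q x‖ ≤ (C + C ^ 2) * Real.exp (α * x) := by
    intro x
    rw [Real.norm_of_nonneg (by positivity), mul_comm (C + C ^ 2)]
    exact mul_le_mul_of_nonneg_left (by nlinarith [hC x, hnonneg x]) (Real.exp_pos _).le
  have hwin := eq_intervalIntegral_of_hasDerivAt hα hqc hderiv hgb hqb
  have hmass : ∫ x, g x = ∫ x, q x := by
    simp_rw [hwin]
    exact integral_intervalIntegral_sub_one hqi
  rw [hmass]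
  have hsum := hqi.hasSum_intervalIntegral (y - 1)
  refine hsum.congr_fun fun k => ?_
  rw [sub_add_eq_add_sub, sub_add_cancel]
  exact hwin (y + k)

theorem shifted_fibre_mass
    (α : ℝ) (hα : 0 < α) (hbar : ℝ → ℝ)
    (hstat : IsStationarySolution α hbar)
    (hdecay : ∃ C > (0:ℝ), ∃ L > (0:ℝ),
      ∀ x : ℝ, 0 < hbar x ∧ hbar x ≤ C * Real.exp (-L * (2:ℝ) ^ x))
    (hnorm : ∫ x : ℝ, Real.exp (α * x) * hbar x = 1) :
    ∀ lam : ℝ,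
      (∑' k : ℤ, Real.exp (α * (k : ℝ)) * hbar ((k : ℝ) - lam) = Real.exp (α * lam)) ∧
      (∀ M : ℝ, 0 < M →
        ((∑' k : ℤ, Real.exp (α * (k : ℝ)) * hbar ((k : ℝ) - lam) = M)
          ↔ lam = Real.log M / α)) := by
  obtain ⟨C, hC, L, hL, hb⟩ := hdecay
  have hbC : ∀ x, hbar x ≤ C := by
    intro x
    refine (hb x).2.trans (mul_le_of_le_one_right hC.le (Real.exp_le_one_iff.2 ?_))
    have : 0 < L * (2 : ℝ) ^ x := by positivity
    linarith
  intro lam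
  have hsum : ∑' k : ℤ, Real.exp (α * (k : ℝ)) * hbar ((k : ℝ) - lam) = Real.exp (α * lam) := by
    have h := (hstat.hasSum_add_int hα hbC (-lam)).mul_left (Real.exp (α * lam))
    rw [hnorm, mul_one] at h
    rw [← h.tsum_eq]
    refine tsum_congr fun k => ?_
    rw [← mul_assoc, ← Real.exp_add, neg_add_eq_sub]
    ring_nf
  refine ⟨hsum, fun M hM => ?_⟩
  rw [hsum, eq_div_iff hα.ne', mul_comm lam]
  refine ⟨fun h => by rw [← h, Real.log_exp], fun h => by rw [h, Real.exp_log hM]⟩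
end

section
/- Let h̄ ∈ C¹(ℝ) ∩ L¹(ℝ; e^{αx}dx) be a nonnegative solution of the stationary equation (S). Then for every x ∈ ℝ one has the integral identity e^{αx} h̄(x) = ∫_{x−1}^{x} h̄(y)² e^{αy} dy. -/
open MeasureTheory Filter

/-- A window integral of `H² e^{-αy}` is controlled by a bound for `H` on the window and `∫ H`. -/
theorem intervalIntegral_sq_mul_exp_le {α M x : ℝ} (hα : 0 < α) {H : ℝ → ℝ}
    (hc : Continuous H) (h0 : ∀ x, 0 ≤ H x) (hi : Integrable H)
    (hM : ∀ y ∈ Set.Icc (x - 1) x, H y ≤ M) :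
    ∫ y in (x - 1)..x, H y ^ 2 * Real.exp (-(α * y))
      ≤ M * (Real.exp (-(α * (x - 1))) * ∫ y, H y) := by
  have hx : x - 1 ≤ x := by linarith
  have hM0 : 0 ≤ M := (h0 x).trans (hM x ⟨hx, le_rfl⟩)
  calc ∫ y in (x - 1)..x, H y ^ 2 * Real.exp (-(α * y))
      ≤ ∫ y in (x - 1)..x, M * Real.exp (-(α * (x - 1))) * H y := by
        refine intervalIntegral.integral_mono_on hx
          (Continuous.intervalIntegrable (by fun_prop) _ _)
          (Continuous.intervalIntegrable (by fun_prop) _ _) fun y hy => ?_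
        have h1 : Real.exp (-(α * y)) ≤ Real.exp (-(α * (x - 1))) :=
          Real.exp_le_exp.2 (neg_le_neg (mul_le_mul_of_nonneg_left hy.1 hα.le))
        calc H y ^ 2 * Real.exp (-(α * y)) = H y * Real.exp (-(α * y)) * H y := by ring
          _ ≤ M * Real.exp (-(α * (x - 1))) * H y := by
            gcongr
            · exact h0 y
            · exact hM y hy
    _ = M * Real.exp (-(α * (x - 1))) * ∫ y in (x - 1)..x, H y :=
        intervalIntegral.integral_const_mul _ _
    _ ≤ M * Real.exp (-(α * (x - 1))) * ∫ y, H y := by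
        rw [intervalIntegral.integral_of_le hx]
        exact mul_le_mul_of_nonneg_left (setIntegral_le_integral hi (Eventually.of_forall h0))
          (by positivity)
    _ = M * (Real.exp (-(α * (x - 1))) * ∫ y, H y) := by ring

/-- An integrable nonnegative `H` differing from the window integral of `H² e^{-αy}` by a constant
equals that window integral. -/
theorem eq_zero_of_eq_const_add_intervalIntegral {α c : ℝ} (hα : 0 < α) {H : ℝ → ℝ}
    (hc : Continuous H) (h0 : ∀ x, 0 ≤ H x) (hi : Integrable H)
    (hH : ∀ x, H x = c + ∫ y in (x - 1)..x, H y ^ 2 * Real.exp (-(α * y))) : c = 0 := by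
  rcases lt_trichotomy c 0 with hneg | h | hpos
  · exfalso
    have hlim : Tendsto (fun x : ℝ => Real.exp (-(α * (x - 1))) * ∫ y, H y) atTop (nhds 0) := by
      have h1 : Tendsto (fun x : ℝ => α * (x - 1)) atTop atTop :=
        (tendsto_atTop_add_const_right _ (-1 : ℝ) tendsto_id).const_mul_atTop hα
      simpa using (Real.tendsto_exp_neg_atTop_nhds_zero.comp h1).mul_const (∫ y, H y)
    obtain ⟨X, hX⟩ := eventually_atTop.1 (hlim.eventually_le_const one_pos)
    obtain ⟨z, -, hz⟩ := isCompact_Icc.exists_isMaxOn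
      (Set.nonempty_Icc.2 (by linarith : X - 1 ≤ X)) hc.continuousOn
    have hbd : ∀ x, X - 1 ≤ x → H x ≤ H z := by
      intro x hx
      obtain ⟨w, hw, hwmax⟩ := isCompact_Icc.exists_isMaxOn
        (Set.nonempty_Icc.2 hx) hc.continuousOn
      refine (hwmax ⟨hx, le_rfl⟩).trans ?_
      rcases le_total w X with hwX | hwX
      · exact hz ⟨hw.1, hwX⟩
      · have h1 := intervalIntegral_sq_mul_exp_le (M := H w) (x := w) hα hc h0 hi
          fun y hy => hwmax ⟨by linarith [hy.1], hy.2.trans hw.2⟩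
        have h2 := mul_le_mul_of_nonneg_left (hX w hwX) (h0 w)
        linarith [hH w]
    have hlim' : Tendsto (fun x : ℝ => H z * (Real.exp (-(α * (x - 1))) * ∫ y, H y))
        atTop (nhds 0) := by simpa using hlim.const_mul (H z)
    obtain ⟨x, hx, hxX⟩ :=
      ((hlim'.eventually_lt_const (neg_pos.2 hneg)).and (eventually_ge_atTop X)).exists
    have h1 := intervalIntegral_sq_mul_exp_le (M := H z) (x := x) hα hc h0 hi
      fun y hy => hbd y (by linarith [hy.1])
    linarith [hH x, h0 x]
  · exact h
  · exfalso
    have hconst : Integrable (fun _ : ℝ => c) := by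
      refine hi.mono' aestronglyMeasurable_const (Eventually.of_forall fun x => ?_)
      rw [Real.norm_of_nonneg hpos.le, hH x]
      have : 0 ≤ ∫ y in (x - 1)..x, H y ^ 2 * Real.exp (-(α * y)) :=
        intervalIntegral.integral_nonneg (by linarith) fun y _ => by positivity
      linarith
    simp [integrable_const_iff, hpos.ne', isFiniteMeasure_iff] at hconst

theorem stationary_integral_identity
    (α : ℝ) (hα : 0 < α) (hbar : ℝ → ℝ)
    (hstat : IsStationarySolution α hbar) :
    ∀ x : ℝ, Real.exp (α * x) * hbar x
      = ∫ y in (x - 1)..x, (hbar y) ^ 2 * Real.exp (α * y) := by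
  obtain ⟨hC, h0, hi, hS⟩ := hstat
  have hcont : Continuous hbar := hC.continuous
  set g : ℝ → ℝ := fun y => hbar y ^ 2 * Real.exp (α * y) with hg
  have hgc : Continuous g := by fun_prop
  set G : ℝ → ℝ := fun x => ∫ y in (0 : ℝ)..x, g y
  have hGd (x : ℝ) : HasDerivAt G (g x) x :=
    intervalIntegral.integral_hasDerivAt_right (hgc.intervalIntegrable _ _)
      (hgc.stronglyMeasurableAtFilter _ _) hgc.continuousAt
  have hwin (x : ℝ) : ∫ y in (x - 1)..x, g y = G x - G (x - 1) :=
    (intervalIntegral.integral_interval_sub_left (hgc.intervalIntegrable _ _)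
      (hgc.intervalIntegrable _ _)).symm
  set D : ℝ → ℝ := fun x => Real.exp (α * x) * hbar x - (G x - G (x - 1))
  have hDd (x : ℝ) : HasDerivAt D 0 x := by
    have hh : HasDerivAt hbar (deriv hbar x) x :=
      (hC.differentiable one_ne_zero x).hasDerivAt
    have he : HasDerivAt (fun x => Real.exp (α * x)) (Real.exp (α * x) * α) x := by
      simpa using ((hasDerivAt_id x).const_mul α).exp
    have hs : HasDerivAt (fun x => G (x - 1)) (g (x - 1)) x := (hGd (x - 1)).comp_sub_const x 1
    refine ((he.mul hh).sub ((hGd x).sub hs)).congr_deriv ?_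
    have hexp : Real.exp (α * (x - 1)) = Real.exp (α * x) * Real.exp (-α) := by
      rw [← Real.exp_add]; ring_nf
    simp only [hg, hexp]
    linear_combination -Real.exp (α * x) * hS x
  have hDc (x : ℝ) : D x = D 0 :=
    is_const_of_deriv_eq_zero (fun x => (hDd x).differentiableAt) (fun x => (hDd x).deriv) x 0
  have hgH (y : ℝ) : (Real.exp (α * y) * hbar y) ^ 2 * Real.exp (-(α * y)) = g y := by
    rw [Real.exp_neg]
    simp only [hg]
    field_simp
  have hD0 : D 0 = 0 := by
    refine eq_zero_of_eq_const_add_intervalIntegral hα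
      (H := fun x => Real.exp (α * x) * hbar x) (by fun_prop)
      (fun x => mul_nonneg (Real.exp_pos _).le (h0 x)) hi fun x => ?_
    simp only [hgH, hwin]
    rw [← hDc x]
    exact (sub_add_cancel _ _).symm
  intro x
  rw [hwin, ← sub_eq_zero]
  exact (hDc x).trans hD0
end

section
/- Let h̄ ∈ C¹(ℝ) ∩ L¹(ℝ; e^{αx}dx) be a nonnegative solution of the stationary equation (S). Then h̄ ∈ L^∞(ℝ), i.e. h̄ is bounded on ℝ. -/
open MeasureTheory Filter

/-- A monotone supersolution of the Riccati equation `ψ' = c ψ²` on `[a, b]` starts at most at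
`1 / (c (b - a))`, since otherwise it would blow up before `b`. -/
theorem mul_le_one_of_riccati_supersolution {ψ ψ' : ℝ → ℝ} {a b c : ℝ} (hab : a ≤ b)
    (hψ : Monotone ψ) (hd : ∀ x, HasDerivAt ψ (ψ' x) x)
    (hric : ∀ x ∈ Set.Icc a b, 0 ≤ ψ x → c * ψ x ^ 2 ≤ ψ' x) (hc : 0 ≤ c) :
    ψ a * (c * (b - a)) ≤ 1 := by
  rcases le_or_gt (ψ a) 0 with ha | ha
  · exact (mul_nonpos_of_nonpos_of_nonneg ha
      (mul_nonneg hc (sub_nonneg.2 hab))).trans zero_le_one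
  have hpos : ∀ x, a ≤ x → 0 < ψ x := fun x hx => ha.trans_le (hψ hx)
  have hder : ∀ x ∈ Set.Icc a b,
      HasDerivAt (fun y => -(ψ y)⁻¹ - c * y) (ψ' x / ψ x ^ 2 - c) x := by
    intro x hx
    refine (((hd x).fun_inv (hpos x hx.1).ne').neg.sub
      ((hasDerivAt_id x).const_mul c)).congr_deriv ?_
    ring
  have hmono : MonotoneOn (fun y => -(ψ y)⁻¹ - c * y) (Set.Icc a b) := by
    refine monotoneOn_of_hasDerivWithinAt_nonneg (convex_Icc a b)
      (fun x hx => (hder x hx).continuousAt.continuousWithinAt)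
      (fun x hx => (hder x (interior_subset hx)).hasDerivWithinAt) fun x hx => ?_
    have hx' := interior_subset hx
    have hx0 := hpos x hx'.1
    rw [sub_nonneg, le_div_iff₀ (by positivity)]
    exact hric x hx' hx0.le
  have h := hmono (Set.left_mem_Icc.2 hab) (Set.right_mem_Icc.2 hab) hab
  have hb : 0 < (ψ b)⁻¹ := inv_pos.2 (hpos b hab)
  simp only at h
  have h' : c * (b - a) ≤ (ψ a)⁻¹ := by linarith
  calc ψ a * (c * (b - a)) ≤ ψ a * (ψ a)⁻¹ := by gcongr
    _ = 1 := mul_inv_cancel₀ ha.ne'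

theorem tendsto_intervalIntegral_sub_one_atTop {g : ℝ → ℝ} (hg : Integrable g) :
    Tendsto (fun x => ∫ s in (x - 1)..x, g s) atTop (nhds 0) := by
  have h1 : Tendsto (fun x : ℝ => ∫ s in (0 : ℝ)..x, g s) atTop
      (nhds (∫ s in Set.Ioi (0 : ℝ), g s)) :=
    intervalIntegral_tendsto_integral_Ioi 0 hg.integrableOn tendsto_id
  have h2 := h1.sub (h1.comp (tendsto_atTop_add_const_right atTop (-1 : ℝ) tendsto_id))
  rw [sub_self] at h2
  refine h2.congr fun x => ?_
  exact intervalIntegral.integral_interval_sub_left hg.intervalIntegrable hg.intervalIntegrable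

/-- If `g = e^{αx} h` equals, up to a constant `k`, the integral of `e^{αx} h²` over the preceding
unit interval, then `h` is at most of order `1 + k e^{-αx}`. -/
theorem exp_mul_le_of_add_const_eq {α k : ℝ} {h Φ : ℝ → ℝ}
    (hΦ : ∀ x, HasDerivAt Φ (Real.exp (α * x) * h x ^ 2) x) (hα : 0 < α)
    (hk : ∀ x, Real.exp (α * x) * h x + k = Φ x - Φ (x - 1)) (x : ℝ) :
    Real.exp (α * x) * h x ≤ k + Real.exp (α * x) * (2 + 2 * Real.exp (α / 2)) := by
  have hmono : Monotone Φ := monotone_of_hasDerivAt_nonneg hΦ fun x => by positivity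
  have key : ∀ a, Φ (a + 1 / 2) - Φ a ≤ k + 2 * Real.exp (α * (a + 1)) := by
    intro a
    have hle := mul_le_one_of_riccati_supersolution (ψ := fun y => Φ y - (Φ a + k))
      (a := a + 1 / 2) (b := a + 1) (c := Real.exp (-(α * (a + 1)))) (by linarith)
      (fun x y hxy => sub_le_sub_right (hmono hxy) _) (fun y => (hΦ y).sub_const _) ?_
      (Real.exp_pos _).le
    · have hE := Real.exp_pos (α * (a + 1))
      rw [Real.exp_neg] at hle
      have : (Φ (a + 1 / 2) - (Φ a + k)) / (2 * Real.exp (α * (a + 1))) ≤ 1 := by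
        refine le_trans (le_of_eq ?_) hle
        field_simp
        ring
      rw [div_le_one (by positivity)] at this
      linarith
    · intro y hy h0
      have h1 : Φ y - (Φ a + k) ≤ Real.exp (α * y) * h y := by
        have := hmono (show y - 1 ≤ a by linarith [hy.2])
        linarith [hk y]
      have h2 : Real.exp (-(α * (a + 1))) ≤ Real.exp (-(α * y)) :=
        Real.exp_le_exp.2 (neg_le_neg (mul_le_mul_of_nonneg_left hy.2 hα.le))
      calc Real.exp (-(α * (a + 1))) * (Φ y - (Φ a + k)) ^ 2
          ≤ Real.exp (-(α * y)) * (Real.exp (α * y) * h y) ^ 2 := by gcongr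
        _ = Real.exp (α * y) * h y ^ 2 := by
          rw [Real.exp_neg]
          field_simp
  have e1 := key (x - 1)
  have e2 := key (x - 1 / 2)
  rw [show x - 1 + 1 / 2 = x - 1 / 2 by ring, sub_add_cancel] at e1
  rw [sub_add_cancel, show α * (x - 1 / 2 + 1) = α * x + α / 2 by ring, Real.exp_add] at e2
  linarith [hk x]

theorem stationary_solution_bounded
    (α : ℝ) (hα : 0 < α) (hbar : ℝ → ℝ)
    (hstat : IsStationarySolution α hbar) :
    ∃ C : ℝ, ∀ x : ℝ, hbar x ≤ C := by
  obtain ⟨hC, hnn, hint, heq⟩ := hstat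
  have hcont : Continuous hbar := hC.continuous
  have hFc : Continuous fun x => Real.exp (α * x) * hbar x ^ 2 := by fun_prop
  have hgc : Continuous fun x => Real.exp (α * x) * hbar x := by fun_prop
  obtain ⟨Φ, hΦd⟩ : ∃ Φ : ℝ → ℝ, Φ = fun x => ∫ s in (0 : ℝ)..x, Real.exp (α * s) * hbar s ^ 2 :=
    ⟨_, rfl⟩
  have hΦ : ∀ x, HasDerivAt Φ (Real.exp (α * x) * hbar x ^ 2) x := fun x => by
    rw [hΦd]
    exact (hFc.integral_hasStrictDerivAt 0 x).hasDerivAt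
  have hΦsub : ∀ a b, Φ b - Φ a = ∫ s in a..b, Real.exp (α * s) * hbar s ^ 2 := fun a b => by
    rw [hΦd]
    exact intervalIntegral.integral_interval_sub_left (hFc.intervalIntegrable _ _)
      (hFc.intervalIntegrable _ _)
  have hmono : Monotone Φ := monotone_of_hasDerivAt_nonneg hΦ fun x => by positivity
  obtain ⟨k, hk⟩ : ∃ k, ∀ x, Real.exp (α * x) * hbar x + k = Φ x - Φ (x - 1) := by
    have hD : ∀ x, HasDerivAt
        (fun y => Φ y - Φ (y - 1) - Real.exp (α * y) * hbar y) 0 x := by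
      intro x
      have hh := (hC.differentiable one_ne_zero x).hasDerivAt
      have hexp := ((hasDerivAt_id x).const_mul α).exp
      refine (((hΦ x).sub ((hΦ (x - 1)).comp_sub_const x 1)).sub (hexp.mul hh)).congr_deriv ?_
      have hx := heq x
      have he : Real.exp (α * (x - 1)) = Real.exp (α * x) * Real.exp (-α) := by
        rw [← Real.exp_add]
        ring_nf
      simp only [id, he]
      linear_combination Real.exp (α * x) * hx
    refine ⟨Φ 0 - Φ (0 - 1) - Real.exp (α * 0) * hbar 0, fun x => ?_⟩
    have := is_const_of_deriv_eq_zero (fun x => (hD x).differentiableAt)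
      (fun x => (hD x).deriv) x 0
    linarith
  have hlim := tendsto_intervalIntegral_sub_one_atTop hint
  have hk_nonneg : 0 ≤ k := by
    refine neg_nonpos.1 (ge_of_tendsto' hlim fun x => ?_)
    have h := intervalIntegral.integral_mono_on (μ := volume) (sub_le_self x zero_le_one)
      (intervalIntegrable_const (c := -k)) (hgc.intervalIntegrable _ _) fun y _ => by
        linarith [hk y, hmono (sub_le_self y zero_le_one)]
    simpa using h
  have hbound := exp_mul_le_of_add_const_eq hΦ hα hk
  have hk_nonpos : k ≤ 0 := by
    set C := k + (2 + 2 * Real.exp (α / 2)) with hCdef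
    have hbd : ∀ y, 0 ≤ y → hbar y ≤ C := by
      intro y hy
      have hE : 1 ≤ Real.exp (α * y) := Real.one_le_exp (by positivity)
      refine le_of_mul_le_mul_left (a := Real.exp (α * y)) ?_ (Real.exp_pos _)
      nlinarith [hbound y, mul_nonneg (sub_nonneg.2 hE) hk_nonneg]
    have hlim' := hlim.const_mul C
    rw [mul_zero] at hlim'
    refine ge_of_tendsto hlim' ((eventually_ge_atTop 1).mono fun x hx => ?_)
    calc k ≤ Φ x - Φ (x - 1) := by
          linarith [hk x, mul_nonneg (Real.exp_pos (α * x)).le (hnn x)]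
      _ = ∫ s in (x - 1)..x, Real.exp (α * s) * hbar s ^ 2 := hΦsub _ _
      _ ≤ ∫ s in (x - 1)..x, C * (Real.exp (α * s) * hbar s) := by
          refine intervalIntegral.integral_mono_on (sub_le_self x zero_le_one)
            (hFc.intervalIntegrable _ _) ((hgc.const_mul C).intervalIntegrable _ _) fun y hy => ?_
          have h1 := mul_le_mul_of_nonneg_right (hbd y (by linarith [hy.1]))
            (mul_nonneg (Real.exp_pos (α * y)).le (hnn y))
          linarith
      _ = C * ∫ s in (x - 1)..x, Real.exp (α * s) * hbar s :=
          intervalIntegral.integral_const_mul _ _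
  refine ⟨2 + 2 * Real.exp (α / 2), fun x => ?_⟩
  refine le_of_mul_le_mul_left (a := Real.exp (α * x)) ?_ (Real.exp_pos _)
  linarith [hbound x]
end

section
/- Let h̄ ∈ C¹(ℝ) ∩ L¹(ℝ; e^{αx}dx) be a nonnegative solution of the stationary equation (S) with ∫_ℝ e^{αx} h̄(x) dx = 1. Then h̄(x) < 8·e^{2α} for every x ∈ ℝ. -/
open MeasureTheory Filter

open scoped Topology

/-- A nonnegative integrable function satisfying `f' ≤ f ^ 2` on `(0, ∞)` vanishes at `+∞`. -/
theorem tendsto_zero_of_integrable_of_deriv_le_sq {f f' : ℝ → ℝ}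
    (hf : ∀ x, HasDerivAt f (f' x) x) (hf0 : ∀ x, 0 ≤ f x) (hfi : Integrable f)
    (hle : ∀ x, 0 < x → f' x ≤ f x ^ 2) : Tendsto f atTop (𝓝 0) := by
  have hcont : Continuous f := continuous_iff_continuousAt.2 fun x => (hf x).continuousAt
  have hmono : MonotoneOn (fun x => x + (1 + f x)⁻¹) (Set.Ici 0) := by
    have hd : ∀ x, HasDerivAt (fun x => x + (1 + f x)⁻¹) (1 + -f' x / (1 + f x) ^ 2) x :=
      fun x => (hasDerivAt_id x).add
        (((hf x).const_add 1).inv (by have := hf0 x; positivity))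
    refine monotoneOn_of_deriv_nonneg (convex_Ici 0)
      (fun x _ => (hd x).continuousAt.continuousWithinAt)
      (fun x _ => (hd x).differentiableAt.differentiableWithinAt) fun x hx => ?_
    rw [interior_Ici, Set.mem_Ioi] at hx
    have h0 := hf0 x
    have : f' x / (1 + f x) ^ 2 ≤ 1 := by
      rw [div_le_one (by positivity)]
      nlinarith [hle x hx]
    rw [(hd x).deriv, neg_div]
    linarith
  have hwindow : ∀ δ : ℝ, Tendsto (fun y => ∫ x in (y - δ)..y, f x) atTop (𝓝 0) := by
    intro δ
    have h1 := intervalIntegral_tendsto_integral_Ioi 0 hfi.integrableOn tendsto_id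
    have h2 := h1.comp (tendsto_atTop_add_const_right atTop (-δ) tendsto_id)
    have h3 := h1.sub h2
    rw [sub_self] at h3
    refine h3.congr fun y => ?_
    simpa [sub_eq_add_neg] using intervalIntegral.integral_interval_sub_left
      (hcont.intervalIntegrable 0 y) (hcont.intervalIntegrable 0 (y - δ))
  have hpsi : Tendsto (fun y => 1 - (1 + f y)⁻¹) atTop (𝓝 0) := by
    rw [Metric.tendsto_atTop']
    intro ε hε
    obtain ⟨N, hN⟩ := eventually_atTop.1
      ((hwindow (ε / 2)).eventually (gt_mem_nhds (show 0 < ε / 2 * (ε / 2) by positivity)))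
    refine ⟨max N (ε / 2), fun y hy => ?_⟩
    have hyN : N ≤ y := (le_max_left _ _).trans hy.le
    have hyε : ε / 2 ≤ y := (le_max_right _ _).trans hy.le
    have hnn : 0 ≤ 1 - (1 + f y)⁻¹ := by
      have := inv_le_one_of_one_le₀ (by linarith [hf0 y] : 1 ≤ 1 + f y)
      linarith
    rw [Real.dist_eq, sub_zero, abs_of_nonneg hnn]
    by_contra! hcon
    have hlow : ∀ x ∈ Set.Icc (y - ε / 2) y, ε / 2 ≤ f x := by
      intro x hx
      have hm := hmono (show x ∈ Set.Ici (0 : ℝ) from by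
        simp only [Set.mem_Ici]; linarith [hx.1])
        (show y ∈ Set.Ici (0 : ℝ) from by simp only [Set.mem_Ici]; linarith) hx.2
      have h0 := hf0 x
      have h1 : 1 - (1 + f x)⁻¹ ≤ f x := by
        have : 1 - (1 + f x)⁻¹ = f x / (1 + f x) := by field_simp; ring
        rw [this]
        exact div_le_self h0 (by linarith)
      simp only at hm
      linarith [hx.1]
    have hint := intervalIntegral.integral_mono_on (by linarith : y - ε / 2 ≤ y)
      intervalIntegrable_const (hcont.intervalIntegrable (μ := volume) _ _) hlow
    rw [intervalIntegral.integral_const, smul_eq_mul] at hint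
    have := hN y hyN
    nlinarith
  have h1 : Tendsto (fun y => (1 - (1 - (1 + f y)⁻¹))⁻¹ - 1) atTop (𝓝 0) := by
    simpa using ((hpsi.const_sub 1).inv₀ (by norm_num)).sub_const 1
  refine h1.congr fun y => ?_
  simp

/-- Riccati-type blow-up: a continuous `f` with `f x ≥ a + ∫ g` and `g ≥ k f ^ 2` cannot exist on
an interval of length at least `1 / (k a)`. -/
theorem mul_lt_one_of_integral_le {f g : ℝ → ℝ} (hg : Continuous g) {a k s t : ℝ}
    (ha : 0 < a) (hk : 0 < k) (hst : s ≤ t)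
    (hgf : ∀ x ∈ Set.Icc s t, k * f x ^ 2 ≤ g x)
    (hfg : ∀ x ∈ Set.Icc s t, a + ∫ y in s..x, g y ≤ f x) : k * a * (t - s) < 1 := by
  set u : ℝ → ℝ := fun x => a + ∫ y in s..x, g y with hu
  have hd : ∀ x, HasDerivAt u (g x) x := fun x =>
    (intervalIntegral.integral_hasDerivAt_right (hg.intervalIntegrable _ _)
      hg.stronglyMeasurable.stronglyMeasurableAtFilter hg.continuousAt).const_add a
  have hpos : ∀ x ∈ Set.Icc s t, 0 < u x := by
    intro x hx
    have : 0 ≤ ∫ y in s..x, g y := intervalIntegral.integral_nonneg hx.1 fun y hy =>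
      (by positivity : (0 : ℝ) ≤ k * f y ^ 2).trans (hgf y ⟨hy.1, hy.2.trans hx.2⟩)
    simp only [hu]
    linarith
  have hanti : AntitoneOn (fun x => (u x)⁻¹ + k * x) (Set.Icc s t) := by
    have hd' : ∀ x ∈ Set.Icc s t,
        HasDerivAt (fun x => (u x)⁻¹ + k * x) (-g x / u x ^ 2 + k * 1) x := fun x hx =>
      ((hd x).inv (hpos x hx).ne').add ((hasDerivAt_id x).const_mul k)
    refine antitoneOn_of_deriv_nonpos (convex_Icc s t)
      (fun x hx => (hd' x hx).continuousAt.continuousWithinAt)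
      (fun x hx => (hd' x (interior_subset hx)).differentiableAt.differentiableWithinAt)
      fun x hx => ?_
    have hx' := interior_subset hx
    have h0 := hpos x hx'
    have : k ≤ g x / u x ^ 2 := by
      rw [le_div_iff₀ (by positivity)]
      refine le_trans ?_ (hgf x hx')
      gcongr
      exact hfg x hx'
    rw [(hd' x hx').deriv, neg_div]
    linarith
  have h := hanti (Set.left_mem_Icc.2 hst) (Set.right_mem_Icc.2 hst) hst
  have hus : u s = a := by simp [hu]
  have hut : 0 < (u t)⁻¹ := inv_pos.2 (hpos t (Set.right_mem_Icc.2 hst))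
  simp only [hus] at h
  have h2 : k * (t - s) < a⁻¹ := by linarith
  calc k * a * (t - s) = a * (k * (t - s)) := by ring
    _ < a * a⁻¹ := by gcongr
    _ = 1 := mul_inv_cancel₀ ha.ne'

/-- If `f' = g - g (· - 1)` and both `f` and `g` vanish at `+∞`, then `f` is the integral of `g`
over the preceding unit window. -/
theorem eq_integral_window_of_hasDerivAt {f g : ℝ → ℝ} (hg : Continuous g)
    (hf : ∀ x, HasDerivAt f (g x - g (x - 1)) x)
    (hf0 : Tendsto f atTop (𝓝 0)) (hg0 : Tendsto g atTop (𝓝 0)) (x : ℝ) :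
    f x = ∫ y in (x - 1)..x, g y := by
  have hG : ∀ x, HasDerivAt (fun x => ∫ y in (0 : ℝ)..x, g y) (g x) x := fun x =>
    intervalIntegral.integral_hasDerivAt_right (hg.intervalIntegrable _ _)
      hg.stronglyMeasurable.stronglyMeasurableAtFilter hg.continuousAt
  have hW : ∀ x, HasDerivAt (fun x => ∫ y in (x - 1)..x, g y) (g x - g (x - 1)) x := by
    intro x
    have h := (hG x).sub ((hG (x - 1)).comp_sub_const x 1)
    refine h.congr_of_eventuallyEq (Eventually.of_forall fun y => ?_)
    exact (intervalIntegral.integral_interval_sub_left (hg.intervalIntegrable _ _)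
      (hg.intervalIntegrable _ _)).symm
  have hconst : ∀ y, f y - ∫ z in (y - 1)..y, g z = f x - ∫ z in (x - 1)..x, g z := fun y =>
    is_const_of_deriv_eq_zero (fun z => ((hf z).sub (hW z)).differentiableAt)
      (fun z => by rw [((hf z).sub (hW z)).deriv, sub_self]) y x
  have hW0 : Tendsto (fun y => ∫ z in (y - 1)..y, g z) atTop (𝓝 0) := by
    rw [Metric.tendsto_atTop]
    intro ε hε
    obtain ⟨N, hN⟩ := Metric.tendsto_atTop.1 hg0 (ε / 2) (by positivity)
    refine ⟨N + 1, fun y hy => ?_⟩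
    have h := intervalIntegral.norm_integral_le_of_norm_le_const (a := y - 1) (b := y) (f := g)
      (C := ε / 2) fun z hz => by
        rw [Set.uIoc_of_le (by linarith)] at hz
        simpa using (hN z (by linarith [hz.1])).le
    rw [sub_sub_cancel, abs_one, mul_one] at h
    rw [dist_zero_right]
    linarith
  have hlim := hf0.sub hW0
  rw [sub_zero] at hlim
  have := tendsto_nhds_unique (hlim.congr hconst) tendsto_const_nhds
  linarith

theorem stationary_solution_explicit_bound
    (α : ℝ) (hα : 0 < α) (hbar : ℝ → ℝ)
    (hstat : IsStationarySolution α hbar)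
    (hnorm : ∫ x : ℝ, Real.exp (α * x) * hbar x = 1) :
    ∀ x : ℝ, hbar x < 8 * Real.exp (2 * α) := by
  obtain ⟨hC, hnn, hint, heq⟩ := hstat
  set f : ℝ → ℝ := fun x => Real.exp (α * x) * hbar x with hf
  set g : ℝ → ℝ := fun x => Real.exp (α * x) * hbar x ^ 2 with hg
  have hgcont : Continuous g := by
    have := hC.continuous
    fun_prop
  have hg0 : ∀ x, 0 ≤ g x := fun x => by positivity
  have hf0 : ∀ x, 0 ≤ f x := fun x => mul_nonneg (Real.exp_pos _).le (hnn x)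
  have hgf : ∀ x, g x = Real.exp (-(α * x)) * f x ^ 2 := by
    intro x
    simp only [hf, hg, Real.exp_neg]
    field_simp
  have hderiv : ∀ x, HasDerivAt f (g x - g (x - 1)) x := by
    intro x
    have h1 : HasDerivAt (fun x => Real.exp (α * x)) (Real.exp (α * x) * (α * 1)) x :=
      ((hasDerivAt_id x).const_mul α).exp
    have h2 := h1.mul (hC.differentiable one_ne_zero x).hasDerivAt
    refine h2.congr_deriv ?_
    have h3 : Real.exp (α * (x - 1)) = Real.exp (α * x) * Real.exp (-α) := by
      rw [← Real.exp_add]; ring_nf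
    simp only [hg, h3]
    linear_combination (-Real.exp (α * x)) * heq x
  have hgle : ∀ x, 0 ≤ x → g x ≤ f x ^ 2 := by
    intro x hx
    rw [hgf]
    exact mul_le_of_le_one_left (sq_nonneg _)
      (Real.exp_le_one_iff.2 (neg_nonpos.2 (by positivity)))
  have hflim : Tendsto f atTop (𝓝 0) :=
    tendsto_zero_of_integrable_of_deriv_le_sq hderiv hf0 hint fun x hx => by
      linarith [hgle x hx.le, hg0 (x - 1)]
  have hglim : Tendsto g atTop (𝓝 0) := by
    refine tendsto_of_tendsto_of_tendsto_of_le_of_le' tendsto_const_nhds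
      (by simpa using hflim.pow 2) (Eventually.of_forall hg0) ?_
    filter_upwards [eventually_ge_atTop 0] with x hx using hgle x hx
  have hwin := eq_integral_window_of_hasDerivAt hgcont hderiv hflim hglim
  have hgi : ∀ a b, IntervalIntegrable g volume a b := fun a b => hgcont.intervalIntegrable a b
  intro x₀
  by_contra! hcon
  have hMpos : 0 < hbar x₀ := lt_of_lt_of_le (by positivity) hcon
  have hfpos : 0 < f x₀ := mul_pos (Real.exp_pos _) hMpos
  have hblow : ∀ s ≤ x₀, f x₀ / 2 ≤ ∫ y in (s - 1 / 2)..s, g y → False := by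
    intro s hs hmass
    have hlt := mul_lt_one_of_integral_le hgcont (f := f) (half_pos hfpos)
      (Real.exp_pos (-(α * (x₀ + 1 / 2)))) (by linarith : s ≤ s + 1 / 2)
      (fun x hx => by
        rw [hgf]
        gcongr
        linarith [hx.2])
      (fun x hx => by
        rw [hwin x, ← intervalIntegral.integral_add_adjacent_intervals (hgi (x - 1) s) (hgi s x),
          ← intervalIntegral.integral_add_adjacent_intervals (hgi (x - 1) (s - 1 / 2))
            (hgi (s - 1 / 2) s)]
        have : 0 ≤ ∫ y in (x - 1)..(s - 1 / 2), g y :=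
          intervalIntegral.integral_nonneg (by linarith [hx.2]) fun y _ => hg0 y
        linarith)
    have hexp : Real.exp (-(α * (x₀ + 1 / 2))) * f x₀ = Real.exp (-(α / 2)) * hbar x₀ := by
      simp only [hf]
      rw [← mul_assoc, ← Real.exp_add]
      ring_nf
    have hbig : 8 ≤ Real.exp (-(α / 2)) * hbar x₀ := by
      calc (8 : ℝ) ≤ 8 * Real.exp (-(α / 2) + 2 * α) :=
            le_mul_of_one_le_right (by norm_num) (Real.one_le_exp (by linarith))
        _ = Real.exp (-(α / 2)) * (8 * Real.exp (2 * α)) := by rw [Real.exp_add]; ring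
        _ ≤ _ := by gcongr
    linarith
  have hsplit := intervalIntegral.integral_add_adjacent_intervals
    (hgi (x₀ - 1) (x₀ - 1 / 2)) (hgi (x₀ - 1 / 2) x₀)
  rw [← hwin x₀] at hsplit
  rcases le_or_gt (f x₀ / 2) (∫ y in (x₀ - 1 / 2)..x₀, g y) with h | h
  · exact hblow x₀ le_rfl h
  · refine hblow (x₀ - 1 / 2) (by linarith) ?_
    rw [show x₀ - 1 / 2 - 1 / 2 = x₀ - 1 by ring]
    linarith
end

section
/- Let h̄₁ and h̄₂ be two nonnegative C¹ solutions of the stationary equation (S) belonging to L¹(ℝ; e^{αx}dx), neither of which is identically zero. Then there exists Λ ∈ ℝ such that h̄₁(x) = h̄₂(x−Λ) for all x ∈ ℝ. -/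
open MeasureTheory Filter

section

open Real Set Topology

/-- An integrable function is at most `ε` at arbitrarily large points. -/
lemma exists_ge_le_of_integrable {g : ℝ → ℝ} (hg : Integrable g) {ε : ℝ} (hε : 0 < ε) (a : ℝ) :
    ∃ x, a ≤ x ∧ g x ≤ ε := by
  by_contra! hlt
  have hconst : IntegrableOn (fun _ : ℝ => ε) (Ioi a) := by
    refine Integrable.mono' hg.integrableOn aestronglyMeasurable_const ?_
    filter_upwards [ae_restrict_mem measurableSet_Ioi] with x hx
    rw [Real.norm_of_nonneg hε.le]
    exact (hlt x (le_of_lt hx)).le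
  rw [integrableOn_const_iff] at hconst
  simp [hε.ne'] at hconst

/-- A function that stays below the Riccati flow `g' ≤ e^{-αx} g²` and starts small at `x₀ ≥ 0`
remains small. -/
lemma le_two_mul_of_riccati {α : ℝ} (hα : 0 < α) {g g' : ℝ → ℝ}
    (hder : ∀ x, HasDerivAt g (g' x) x) (hle : ∀ x, g' x ≤ exp (-α * x) * g x ^ 2)
    {ε x₀ : ℝ} (hε : 0 < ε) (hεα : 4 * ε < α) (hx₀ : 0 ≤ x₀) (h₀ : g x₀ ≤ ε)
    {x : ℝ} (hx : x₀ ≤ x) : g x ≤ 2 * ε := by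
  have hB : ∀ y, HasDerivAt (fun y => ε * (2 - exp (-α * (y - x₀))))
      (ε * α * exp (-α * (y - x₀))) y := by
    intro y
    have h := (((((hasDerivAt_id y).sub_const x₀).const_mul (-α)).exp).const_sub 2).const_mul ε
    refine h.congr_deriv ?_
    simp only [id]
    ring
  have key := image_le_of_deriv_right_lt_deriv_boundary (f := g) (f' := g') (a := x₀) (b := x)
    (fun y _ => (hder y).continuousAt.continuousWithinAt)
    (fun y _ => (hder y).hasDerivWithinAt) (by simpa using (by linarith : g x₀ ≤ ε * (2 - 1)))
    hB ?_ (right_mem_Icc.2 hx)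
  · refine key.trans ?_
    have := exp_pos (-α * (x - x₀))
    nlinarith
  · intro y hy hgy
    have hexp : exp (-α * (y - x₀)) = exp (-α * y) * exp (α * x₀) := by
      rw [← exp_add]; ring_nf
    have h1 : 1 ≤ exp (α * x₀) := one_le_exp (by positivity)
    have hpos := exp_pos (-α * y)
    have hEpos := exp_pos (-α * (y - x₀))
    have hE1 : exp (-α * (y - x₀)) ≤ 1 := by
      rw [exp_le_one_iff]; nlinarith [hy.1]
    have hsq : g y ^ 2 ≤ 4 * ε ^ 2 := by
      have : (2 - exp (-α * (y - x₀))) ^ 2 ≤ 4 := by nlinarith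
      rw [hgy, mul_pow]
      nlinarith [sq_nonneg ε]
    calc g' y ≤ exp (-α * y) * g y ^ 2 := hle y
      _ ≤ exp (-α * y) * (4 * ε ^ 2) := by gcongr
      _ < exp (-α * y) * (ε * α) := by
          apply mul_lt_mul_of_pos_left _ hpos; nlinarith
      _ ≤ exp (-α * y) * (ε * α) * exp (α * x₀) := le_mul_of_one_le_right (by positivity) h1
      _ = ε * α * exp (-α * (y - x₀)) := by rw [hexp]; ring

/-- If the unit increments of a monotone function are given by an integrable function `g`, then the
function has limits at both ends, and they differ by the integral of `g`. -/
lemma Monotone.exists_tendsto_of_integrable_increment {Φ g : ℝ → ℝ} (hΦ : Monotone Φ)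
    (hcont : Continuous Φ) (hg : Integrable g) (hg0 : ∀ x, 0 ≤ g x)
    (hinc : ∀ x, Φ x - Φ (x - 1) = g x) :
    ∃ l, Tendsto Φ atBot (𝓝 l) ∧ Tendsto Φ atTop (𝓝 (l + ∫ x, g x)) := by
  have hint : ∀ a b, IntervalIntegrable Φ volume a b := fun a b => hcont.intervalIntegrable a b
  have hshift : ∀ a b : ℝ, ∫ x in a..b, g x = (∫ x in b - 1..b, Φ x) - ∫ x in a - 1..a, Φ x := by
    intro a b
    have hs : ∫ x in a..b, Φ (x - 1) = ∫ x in a - 1..b - 1, Φ x :=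
      intervalIntegral.integral_comp_sub_right Φ 1
    have e1 := intervalIntegral.integral_add_adjacent_intervals (hint (a - 1) a) (hint a b)
    have e2 := intervalIntegral.integral_add_adjacent_intervals
      (hint (a - 1) (b - 1)) (hint (b - 1) b)
    calc ∫ x in a..b, g x = ∫ x in a..b, (Φ x - Φ (x - 1)) := by simp only [hinc]
      _ = (∫ x in a..b, Φ x) - ∫ x in a..b, Φ (x - 1) :=
          intervalIntegral.integral_sub (hint a b)
            ((hcont.comp (continuous_id.sub continuous_const)).intervalIntegrable a b)
      _ = _ := by rw [hs]; linarith
  have hlow : ∀ b, Φ (b - 1) ≤ ∫ x in b - 1..b, Φ x := by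
    intro b
    have h := intervalIntegral.integral_mono_on (a := b - 1) (b := b) (by linarith)
      (intervalIntegrable_const (μ := volume) (c := Φ (b - 1))) (hint _ _) (fun x hx => hΦ hx.1)
    simpa using h
  have hupp : ∀ b, ∫ x in b - 1..b, Φ x ≤ Φ b := by
    intro b
    have h := intervalIntegral.integral_mono_on (a := b - 1) (b := b) (by linarith)
      (hint _ _) (intervalIntegrable_const (μ := volume) (c := Φ b)) (fun x hx => hΦ hx.2)
    simpa using h
  have hle : ∀ a b, a ≤ b → ∫ x in a..b, g x ≤ ∫ x, g x := by
    intro a b hab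
    rw [intervalIntegral.integral_of_le hab]
    exact setIntegral_le_integral hg (Eventually.of_forall hg0)
  have hbdd : ∀ a b, a ≤ b → Φ (b - 1) - Φ a ≤ ∫ x, g x := by
    intro a b hab
    have := hle a b hab
    rw [hshift] at this
    linarith [hlow b, hupp a]
  have hI : 0 ≤ ∫ x, g x := integral_nonneg hg0
  have htop : Tendsto Φ atTop (𝓝 (⨆ x, Φ x)) := by
    refine tendsto_atTop_ciSup hΦ ⟨Φ 0 + ∫ x, g x, ?_⟩
    rintro _ ⟨x, rfl⟩
    rcases le_total x 0 with hx | hx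
    · linarith [hΦ hx]
    · have := hbdd 0 (x + 1) (by linarith)
      rw [add_sub_cancel_right] at this
      linarith
  have hbot : Tendsto Φ atBot (𝓝 (⨅ x, Φ x)) := by
    refine tendsto_atBot_ciInf hΦ ⟨Φ 0 - ∫ x, g x, ?_⟩
    rintro _ ⟨x, rfl⟩
    rcases le_total x 0 with hx | hx
    · have := hbdd x 1 (by linarith)
      rw [sub_self] at this
      linarith
    · linarith [hΦ hx]
  refine ⟨_, hbot, ?_⟩
  have hlim : Tendsto (fun t : ℝ => ∫ x in -t..t, g x) atTop (𝓝 (∫ x, g x)) :=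
    intervalIntegral_tendsto_integral hg tendsto_neg_atTop_atBot tendsto_id
  have hsub : Tendsto (fun t : ℝ => t - 1) atTop atTop :=
    tendsto_atTop_add_const_right _ (-1) tendsto_id
  have hsub' : Tendsto (fun t : ℝ => -t - 1) atTop atBot :=
    tendsto_atBot_add_const_right _ (-1) tendsto_neg_atTop_atBot
  have hlim' : Tendsto (fun t : ℝ => ∫ x in -t..t, g x) atTop (𝓝 ((⨆ x, Φ x) - ⨅ x, Φ x)) := by
    refine tendsto_of_tendsto_of_tendsto_of_le_of_le
      ((htop.comp hsub).sub (hbot.comp tendsto_neg_atTop_atBot))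
      (htop.sub (hbot.comp hsub')) (fun t => ?_) (fun t => ?_)
    · simp only [Function.comp, hshift]
      linarith [hlow t, hupp (-t)]
    · simp only [Function.comp, hshift]
      linarith [hlow (-t), hupp t]
  have := tendsto_nhds_unique hlim hlim'
  rwa [this, add_sub_cancel]

/-- Integrated form of the stationary equation. -/
lemma IsStationarySolution.exists_primitive {α : ℝ} (hα : 0 < α) {h : ℝ → ℝ}
    (hh : IsStationarySolution α h) :
    ∃ Φ : ℝ → ℝ, (∀ x, HasDerivAt Φ (exp (α * x) * h x ^ 2) x) ∧
      (∀ x, Φ x - Φ (x - 1) = exp (α * x) * h x) ∧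
      Tendsto Φ atBot (𝓝 0) ∧ Tendsto Φ atTop (𝓝 (∫ x, exp (α * x) * h x)) := by
  obtain ⟨hC1, hnn, hInt, heq⟩ := hh
  have hcont : Continuous h := hC1.continuous
  have hFcont : Continuous fun x => exp (α * x) * h x ^ 2 := by fun_prop
  set Φ₀ : ℝ → ℝ := fun x => ∫ y in (0 : ℝ)..x, exp (α * y) * h y ^ 2
  have hd : ∀ x, HasDerivAt Φ₀ (exp (α * x) * h x ^ 2) x := fun x =>
    intervalIntegral.integral_hasDerivAt_right (hFcont.intervalIntegrable _ _)
      (hFcont.stronglyMeasurableAtFilter _ _) hFcont.continuousAt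
  have hmono : Monotone Φ₀ :=
    monotone_of_deriv_nonneg (fun x => (hd x).differentiableAt)
      (fun x => by rw [(hd x).deriv]; positivity)
  have hgd : ∀ x, HasDerivAt (fun x => exp (α * x) * h x)
      (exp (α * x) * h x ^ 2 - exp (α * (x - 1)) * h (x - 1) ^ 2) x := by
    intro x
    have h1 := (hC1.differentiable one_ne_zero x).hasDerivAt
    have h2 := (((hasDerivAt_id x).const_mul α).exp).mul h1
    refine h2.congr_deriv ?_
    have e : exp (α * (x - 1)) = exp (α * x) * exp (-α) := by rw [← exp_add]; ring_nf
    simp only [id, mul_one]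
    rw [e]
    linear_combination (-exp (α * x)) * heq x
  have hkd : ∀ x, HasDerivAt (fun x => exp (α * x) * h x - (Φ₀ x - Φ₀ (x - 1))) 0 x := by
    intro x
    have h1 : HasDerivAt (fun x => Φ₀ (x - 1)) (exp (α * (x - 1)) * h (x - 1) ^ 2) x :=
      (hd (x - 1)).comp_sub_const x 1
    exact ((hgd x).sub ((hd x).sub h1)).congr_deriv (sub_self _)
  obtain ⟨C, hC⟩ : ∃ C, ∀ x, exp (α * x) * h x - (Φ₀ x - Φ₀ (x - 1)) = C :=
    ⟨_, fun x => is_const_of_deriv_eq_zero (fun x => (hkd x).differentiableAt)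
      (fun x => (hkd x).deriv) x 0⟩
  have hCle : C ≤ 0 := by
    refine le_of_forall_pos_le_add fun ε hε => ?_
    obtain ⟨x, -, hx⟩ := exists_ge_le_of_integrable hInt hε 0
    linarith [hC x, hmono (by linarith : x - 1 ≤ x)]
  have hCge : 0 ≤ C := by
    by_contra! hneg
    obtain ⟨ε, hε, hε1⟩ : ∃ ε > 0, ε < min (α / 4) (min 1 (-C / 4)) :=
      exists_between (lt_min (by positivity) (lt_min one_pos (by linarith)))
    have hεα := hε1.trans_le (min_le_left _ _)
    have hε1' := hε1.trans_le ((min_le_right _ _).trans (min_le_left _ _))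
    have hεC := hε1.trans_le ((min_le_right _ _).trans (min_le_right _ _))
    obtain ⟨x₀, hx₀, hx₀ε⟩ := exists_ge_le_of_integrable hInt hε 0
    have hsq : ∀ x, exp (α * x) * h x ^ 2 = exp (-α * x) * (exp (α * x) * h x) ^ 2 := by
      intro x
      have : exp (-α * x) * exp (α * x) = 1 := by rw [← exp_add]; simp
      linear_combination (-exp (α * x) * h x ^ 2) * this
    have hsmall : ∀ x, x₀ ≤ x → exp (α * x) * h x ^ 2 ≤ 4 * ε ^ 2 := by
      intro x hx
      have hgx := le_two_mul_of_riccati hα hgd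
        (fun y => by rw [← hsq]; exact sub_le_self _ (by positivity)) hε (by linarith) hx₀ hx₀ε hx
      have hg0 : 0 ≤ exp (α * x) * h x := mul_nonneg (exp_pos _).le (hnn x)
      have hE : exp (-α * x) ≤ 1 := by
        rw [exp_le_one_iff]; nlinarith
      rw [hsq]
      calc _ ≤ 1 * (2 * ε) ^ 2 := by gcongr
        _ = _ := by ring
    have hstep : Φ₀ (x₀ + 1) - Φ₀ x₀ ≤ 4 * ε ^ 2 * (x₀ + 1 - x₀) :=
      (convex_Ici x₀).image_sub_le_mul_sub_of_deriv_le
        (fun x _ => (hd x).continuousAt.continuousWithinAt)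
        (fun x _ => (hd x).differentiableAt.differentiableWithinAt)
        (fun x hx => by
          rw [(hd x).deriv]
          exact hsmall x (interior_subset hx))
        x₀ self_mem_Ici (x₀ + 1) (by simp) (by linarith)
    have h1 := hC (x₀ + 1)
    rw [add_sub_cancel_right] at h1
    have h2 : 0 ≤ exp (α * (x₀ + 1)) * h (x₀ + 1) := mul_nonneg (exp_pos _).le (hnn _)
    nlinarith
  have hinc : ∀ x, Φ₀ x - Φ₀ (x - 1) = exp (α * x) * h x := fun x => by linarith [hC x]
  obtain ⟨l, hl, hl'⟩ := hmono.exists_tendsto_of_integrable_increment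
    (continuous_iff_continuousAt.2 fun x => (hd x).continuousAt) hInt
    (fun x => mul_nonneg (exp_pos _).le (hnn x)) hinc
  refine ⟨fun x => Φ₀ x - l, fun x => (hd x).sub_const l, fun x => ?_, ?_, ?_⟩
  · rw [← hinc]; ring
  · simpa using hl.sub_const l
  · simpa using hl'.sub_const l

/-- Maximum principle: a differentiable function vanishing at `±∞` whose critical points `x`
satisfy `P x = P (x - 1)` is nonpositive. -/
lemma nonpos_of_critical_eq_shift {P P' : ℝ → ℝ} (hd : ∀ x, HasDerivAt P (P' x) x)
    (hbot : Tendsto P atBot (𝓝 0)) (htop : Tendsto P atTop (𝓝 0))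
    (hcrit : ∀ x, P' x = 0 → P x = P (x - 1)) (x : ℝ) : P x ≤ 0 := by
  by_contra! hx
  obtain ⟨m, hm⟩ : ∃ m, ∀ y, P y ≤ P m := by
    refine (continuous_iff_continuousAt.2 fun x => (hd x).continuousAt).exists_forall_ge' x ?_
    rw [cocompact_eq_atBot_atTop, eventually_sup]
    exact ⟨(hbot.eventually_lt_const hx).mono fun _ h => h.le,
      (htop.eventually_lt_const hx).mono fun _ h => h.le⟩
  have hn : ∀ n : ℕ, P (m - n) = P m := by
    intro n
    induction n with
    | zero => simp
    | succ k ih =>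
      have hmax : IsLocalMax P (m - k) := Eventually.of_forall fun y => ih ▸ hm y
      have := hcrit _ (hmax.hasDerivAt_eq_zero (hd _))
      rw [← ih, this]
      push_cast
      ring_nf
  have hseq : Tendsto (fun n : ℕ => m - (n : ℝ)) atTop atBot :=
    tendsto_const_nhds.add_atBot (tendsto_neg_atTop_atBot.comp tendsto_natCast_atTop_atTop)
  have hlim := hbot.comp hseq
  simp only [Function.comp_def, hn] at hlim
  have := tendsto_nhds_unique hlim tendsto_const_nhds
  linarith [hm x]

/-- A stationary solution is determined by its weighted mass. -/
lemma IsStationarySolution.eq_of_integral_eq {α : ℝ} (hα : 0 < α) {h₁ h₂ : ℝ → ℝ}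
    (hh₁ : IsStationarySolution α h₁) (hh₂ : IsStationarySolution α h₂)
    (hI : ∫ x, exp (α * x) * h₁ x = ∫ x, exp (α * x) * h₂ x) : h₁ = h₂ := by
  obtain ⟨Φ₁, hd₁, hi₁, hb₁, ht₁⟩ := hh₁.exists_primitive hα
  obtain ⟨Φ₂, hd₂, hi₂, hb₂, ht₂⟩ := hh₂.exists_primitive hα
  have hcrit : ∀ x, exp (α * x) * h₁ x ^ 2 = exp (α * x) * h₂ x ^ 2 →
      Φ₁ x - Φ₁ (x - 1) = Φ₂ x - Φ₂ (x - 1) := by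
    intro x hx
    have hsq := mul_left_cancel₀ (exp_pos (α * x)).ne' hx
    rw [hi₁, hi₂, (pow_left_inj₀ (hh₁.2.1 x) (hh₂.2.1 x) two_ne_zero).1 hsq]
  have hle : ∀ x, Φ₁ x - Φ₂ x ≤ 0 :=
    nonpos_of_critical_eq_shift (fun x => (hd₁ x).sub (hd₂ x))
      (by simpa using hb₁.sub hb₂) (by simpa [hI] using ht₁.sub ht₂)
      (fun x hx => by linarith [hcrit x (by linarith)])
  have hge : ∀ x, Φ₂ x - Φ₁ x ≤ 0 :=
    nonpos_of_critical_eq_shift (fun x => (hd₂ x).sub (hd₁ x))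
      (by simpa using hb₂.sub hb₁) (by simpa [hI] using ht₂.sub ht₁)
      (fun x hx => by linarith [hcrit x (by linarith)])
  funext x
  refine mul_left_cancel₀ (exp_pos (α * x)).ne' ?_
  linarith [hi₁ x, hi₂ x, hle x, hge x, hle (x - 1), hge (x - 1)]

lemma exp_mul_shift (α Λ : ℝ) (h : ℝ → ℝ) :
    (fun x => exp (α * x) * h (x - Λ)) =
      fun x => exp (α * Λ) * (exp (α * (x - Λ)) * h (x - Λ)) := by
  funext x
  rw [← mul_assoc, ← exp_add]
  ring_nf

lemma IsStationarySolution.shift {α : ℝ} {h : ℝ → ℝ} (hh : IsStationarySolution α h) (Λ : ℝ) :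
    IsStationarySolution α (fun x => h (x - Λ)) := by
  obtain ⟨hC1, hnn, hInt, heq⟩ := hh
  refine ⟨hC1.comp (contDiff_id.sub contDiff_const), fun x => hnn _, ?_, fun x => ?_⟩
  · rw [exp_mul_shift]
    exact (hInt.comp_sub_right Λ).const_mul _
  · rw [deriv_comp_sub_const]
    simpa only [sub_right_comm] using heq (x - Λ)

lemma IsStationarySolution.integral_pos {α : ℝ} {h : ℝ → ℝ} (hh : IsStationarySolution α h)
    (hne : ∃ x, h x ≠ 0) : 0 < ∫ x, exp (α * x) * h x := by
  obtain ⟨hC1, hnn, hInt, -⟩ := hh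
  obtain ⟨x, hx⟩ := hne
  have hcont : Continuous h := hC1.continuous
  exact integral_pos_of_integrable_nonneg_nonzero (x := x) (by fun_prop) hInt
    (fun y => mul_nonneg (exp_pos _).le (hnn y)) (mul_ne_zero (exp_pos _).ne' hx)

end

theorem stationary_solution_unique_up_to_shift
    (α : ℝ) (hα : 0 < α) (hbar₁ hbar₂ : ℝ → ℝ)
    (hstat₁ : IsStationarySolution α hbar₁)
    (hstat₂ : IsStationarySolution α hbar₂)
    (hne₁ : ∃ x : ℝ, hbar₁ x ≠ 0)
    (hne₂ : ∃ x : ℝ, hbar₂ x ≠ 0) :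
    ∃ Λ : ℝ, ∀ x : ℝ, hbar₁ x = hbar₂ (x - Λ) := by
  have h₁ := hstat₁.integral_pos hne₁
  have h₂ := hstat₂.integral_pos hne₂
  refine ⟨Real.log ((∫ x, Real.exp (α * x) * hbar₁ x) / ∫ x, Real.exp (α * x) * hbar₂ x) / α,
    congrFun (hstat₁.eq_of_integral_eq hα (hstat₂.shift _) ?_)⟩
  rw [exp_mul_shift, integral_const_mul,
    integral_sub_right_eq_self (fun x => Real.exp (α * x) * hbar₂ x), mul_div_cancel₀ _ hα.ne',
    Real.exp_log (div_pos h₁ h₂), div_mul_cancel₀ _ h₂.ne']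
end

section
/- Fix α > 0, a reference profile h̄, θ ∈ [0,1), m ∈ (0,∞) with λ := (ln m)/α, constants c₀ > 0, ε > 0 and N ∈ ℕ such that Σ_{|k|≥N} e^{αk} φ̄_k(t) ≤ 2e^{α}ε for all t, where φ̄_k(t) := h̄(k+1−λ−ψ(t,θ)). Then there exists ν > 0 (depending on θ, N, ε, m, c₀ and h̄) with the following property: for every family q = (q_k)_{k∈ℤ} of nonnegative C¹ functions on (θ,θ+1) solving d/dt q_k = α·q_k + e^{−α}·q_{k−1}² − q_k², satisfying Σ_{k∈ℤ} e^{αk} q_k(t) = e^{α(ψ(t,θ)−1)}·m, sup_{t,k} q_k(t) ≤ c₀, the tightness bound Σ_{|k|≥N} e^{αk} q_k(t) ≤ 2e^{α}ε for all t, and the lower bound Σ_{k∈ℤ} e^{αk} (q_k(t) − φ̄_k(t))₊ ≥ 16e^{α}ε on [θ,θ+1), one has ∫_θ^{θ+1} Σ_{k∈ℤ} e^{αk} (q_k(t)+φ̄_k(t))·ω_k(t)·[sign₊(ω_k(t)) − sign₊(ω_{k+1}(t))] dt ≥ ν, where ω_k := q_k − φ̄_k. -/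
open MeasureTheory Filter

/-- `ψ(t,θ) = t - θ - ⌊t - θ⌋ ∈ [0,1)`. -/
noncomputable def psi (t θ : ℝ) : ℝ := t - θ - (⌊t - θ⌋ : ℤ)

/-- `sign₊(r) = 1` if `r > 0` and `0` otherwise. -/
noncomputable def signPlus (r : ℝ) : ℝ := if 0 < r then 1 else 0

/-- A reference profile: a nonnegative `C¹` solution of the stationary equation (S)
in `L¹(ℝ; e^{αx} dx)`, positive with double-exponential decay, of total mass one. -/
def IsRefProfile (α : ℝ) (hbar : ℝ → ℝ) : Prop :=
  ContDiff ℝ 1 hbar ∧ (∀ x, 0 ≤ hbar x) ∧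
    Integrable (fun x => Real.exp (α * x) * hbar x) ∧
    (∀ x : ℝ, 0 = deriv hbar x + α * hbar x
      + Real.exp (-α) * (hbar (x - 1)) ^ 2 - (hbar x) ^ 2) ∧
    (∃ C > (0:ℝ), ∃ L > (0:ℝ),
      ∀ x : ℝ, 0 < hbar x ∧ hbar x ≤ C * Real.exp (-L * (2:ℝ) ^ x)) ∧
    (∫ x : ℝ, Real.exp (α * x) * hbar x) = 1

/-- The `k`-th rescaled translate of the reference profile along the fibre `θ`
with shift `lam`: `φ̄_k(t) = h̄(k + 1 - λ - ψ(t,θ))`. -/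
noncomputable def phibar (hbar : ℝ → ℝ) (lam θ : ℝ) (k : ℤ) (t : ℝ) : ℝ :=
  hbar ((k : ℝ) + 1 - lam - psi t θ)

/-- A reference profile is bounded. -/
lemma IsRefProfile.exists_bound {α : ℝ} {h : ℝ → ℝ} (href : IsRefProfile α h) :
    ∃ C > (0 : ℝ), ∀ x, h x ≤ C := by
  obtain ⟨-, -, -, -, ⟨C, hC, L, hL, hb⟩, -⟩ := href
  refine ⟨C, hC, fun x => (hb x).2.trans ?_⟩
  have : Real.exp (-L * (2 : ℝ) ^ x) ≤ 1 := by
    rw [Real.exp_le_one_iff]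
    have : (0 : ℝ) < (2 : ℝ) ^ x := by positivity
    nlinarith
  nlinarith

/-- The weighted profile is the moving average of the weighted squared profile. -/
lemma IsRefProfile.exp_mul_eq_integral {α : ℝ} (hα : 0 < α) {h : ℝ → ℝ}
    (href : IsRefProfile α h) (x : ℝ) :
    Real.exp (α * x) * h x = ∫ y in (x - 1)..x, Real.exp (α * y) * h y ^ 2 := by
  obtain ⟨C, hC, hb⟩ := href.exists_bound
  obtain ⟨hcd, hnn, -, heq, -, -⟩ := href
  have hcont : Continuous h := hcd.continuous
  have hdiff : Differentiable ℝ h := hcd.differentiable (by norm_num)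
  set P : ℝ → ℝ := fun y => Real.exp (α * y) * h y ^ 2 with hP
  have hPc : Continuous P := by fun_prop
  set G : ℝ → ℝ := fun y => Real.exp (α * y) * h y - ∫ z in (y - 1)..y, P z with hG
  have hGd : ∀ y, HasDerivAt G 0 y := by
    intro y
    have h1 : HasDerivAt (fun y => Real.exp (α * y) * h y)
        (Real.exp (α * y) * (α * 1) * h y + Real.exp (α * y) * deriv h y) y :=
      ((hasDerivAt_id y).const_mul α).exp.mul (hdiff y).hasDerivAt
    have h2 : ∀ z, HasDerivAt (fun u => ∫ z in (0 : ℝ)..u, P z) (P z) z := fun z =>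
      (hPc.integral_hasStrictDerivAt 0 z).hasDerivAt
    have h3 : HasDerivAt (fun y => ∫ z in (y - 1)..y, P z) (P y - P (y - 1)) y := by
      have h4 := (h2 y).sub ((h2 (y - 1)).comp_sub_const y 1)
      refine h4.congr_of_eventuallyEq (Eventually.of_forall fun u => ?_)
      exact (intervalIntegral.integral_interval_sub_left (hPc.intervalIntegrable _ _)
        (hPc.intervalIntegrable _ _)).symm
    have h5 := h1.sub h3
    refine h5.congr_deriv ?_
    have e := heq y
    have e2 : P (y - 1) = Real.exp (α * y) * (Real.exp (-α) * h (y - 1) ^ 2) := by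
      simp only [hP]
      rw [← mul_assoc, ← Real.exp_add]
      ring_nf
    rw [e2]
    simp only [hP]
    linear_combination (-Real.exp (α * y)) * e
  have hconst : ∀ y, G x = G y := fun y =>
    is_const_of_deriv_eq_zero (fun y => (hGd y).differentiableAt) (fun y => (hGd y).deriv) x y
  have hbound : ∀ y, |G y| ≤ Real.exp (α * y) * (C + C ^ 2) := by
    intro y
    have h1 : ‖∫ z in (y - 1)..y, P z‖ ≤ Real.exp (α * y) * C ^ 2 * |y - (y - 1)| := by
      refine intervalIntegral.norm_integral_le_of_norm_le_const fun z hz => ?_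
      rw [Set.uIoc_of_le (by linarith)] at hz
      have : 0 ≤ P z := by simp only [hP]; positivity
      rw [Real.norm_of_nonneg this]
      have : Real.exp (α * z) ≤ Real.exp (α * y) := by
        apply Real.exp_le_exp.2; nlinarith [hz.2]
      simp only [hP]
      have := hnn z
      have := hb z
      gcongr
    rw [show y - (y - 1) = 1 by ring, abs_one, mul_one, Real.norm_eq_abs] at h1
    have h2 : |Real.exp (α * y) * h y| ≤ Real.exp (α * y) * C := by
      rw [abs_of_nonneg (mul_nonneg (Real.exp_nonneg _) (hnn y))]
      have := hb y
      gcongr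
    calc |G y| ≤ |Real.exp (α * y) * h y| + |∫ z in (y - 1)..y, P z| := abs_sub _ _
      _ ≤ _ := by linarith
  have hlim : Tendsto (fun y => Real.exp (α * y) * (C + C ^ 2)) atBot (nhds (0 * (C + C ^ 2))) :=
    (Real.tendsto_exp_atBot.comp (tendsto_id.const_mul_atBot hα)).mul_const _
  rw [zero_mul] at hlim
  have h0 : |G x| ≤ 0 := ge_of_tendsto hlim <| Eventually.of_forall fun y => by
    rw [hconst y]; exact hbound y
  have : G x = 0 := abs_nonpos_iff.1 h0
  simp only [hG] at this
  linarith

/-- The lattice sums of the weighted profile all equal its total mass. -/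
lemma IsRefProfile.hasSum {α : ℝ} (hα : 0 < α) {h : ℝ → ℝ} (href : IsRefProfile α h) (x : ℝ) :
    HasSum (fun k : ℤ => Real.exp (α * (x + k)) * h (x + k)) 1 := by
  obtain ⟨C, hC, hb⟩ := href.exists_bound
  have hrep := href.exp_mul_eq_integral hα
  obtain ⟨hcd, hnn, hint, -, -, hmass⟩ := href
  have hcont : Continuous h := hcd.continuous
  have hPint : Integrable fun y => Real.exp (α * y) * h y ^ 2 := by
    have := hint.bdd_mul (f := h) (c := C) hcont.aestronglyMeasurable
      (Eventually.of_forall fun y => by rw [Real.norm_of_nonneg (hnn y)]; exact hb y)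
    refine this.congr (Eventually.of_forall fun y => ?_)
    ring
  have key : ∀ x : ℝ, HasSum (fun k : ℤ => Real.exp (α * (x + k)) * h (x + k))
      (∫ y, Real.exp (α * y) * h y ^ 2) := by
    intro x
    have e : (fun k : ℤ => Real.exp (α * (x + k)) * h (x + k)) = fun k : ℤ =>
        ∫ y in (x - 1 + k)..(x - 1 + k + 1), Real.exp (α * y) * h y ^ 2 := by
      funext k
      rw [hrep]
      congr 1 <;> ring
    rw [e]
    exact hPint.hasSum_intervalIntegral (x - 1)
  suffices hs : ∫ y, Real.exp (α * y) * h y ^ 2 = 1 by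
    rw [← hs]; exact key x
  have h2 := hint.hasSum_intervalIntegral_comp_add_int
  simp only [intervalIntegral.integral_of_le zero_le_one] at h2
  have h3 := integral_tsum_of_summable_integral_norm
    (μ := volume.restrict (Set.Ioc (0 : ℝ) 1))
    (F := fun (k : ℤ) x => Real.exp (α * (x + k)) * h (x + k))
    (fun k => (Continuous.integrableOn_Ioc (by fun_prop)))
    (by
      refine h2.summable.congr fun k => ?_
      refine integral_congr_ae (Eventually.of_forall fun y => ?_)
      exact (Real.norm_of_nonneg (mul_nonneg (Real.exp_nonneg _) (hnn _))).symm)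
  rw [h2.tsum_eq, hmass] at h3
  simp only [fun x => (key x).tsum_eq] at h3
  simpa using h3.symm

/-- Splitting off the tail of a lattice sum. -/
lemma sum_Ioo_ge_of_tail_le {f g : ℤ → ℝ} {A B : ℝ} (N : ℕ) (hf : ∀ k, 0 ≤ f k)
    (hfg : ∀ k, f k ≤ g k) (hg : Summable g)
    (htail : ∑' k : {k : ℤ // (N : ℤ) ≤ |k|}, g k ≤ B) (hA : A ≤ ∑' k, f k) :
    A - B ≤ ∑ k ∈ Finset.Ioo (-(N : ℤ)) N, f k := by
  have hfs : Summable f := Summable.of_nonneg_of_le hf hfg hg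
  have h1 := hfs.tsum_subtype_add_tsum_subtype_compl {k : ℤ | (N : ℤ) ≤ |k|}
  have h2 : ({k : ℤ | (N : ℤ) ≤ |k|}ᶜ : Set ℤ) = ↑(Finset.Ioo (-(N : ℤ)) N) := by
    ext k
    simp [abs_lt]
  rw [h2, Finset.tsum_subtype'] at h1
  have h3 : ∑' k : {k : ℤ // (N : ℤ) ≤ |k|}, f k ≤ ∑' k : {k : ℤ // (N : ℤ) ≤ |k|}, g k :=
    Summable.tsum_le_tsum (fun k => hfg k) (hfs.subtype _) (hg.subtype _)
  have h4 : ∑' k : {k : ℤ | (N : ℤ) ≤ |k|}, f k = ∑' k : {k : ℤ // (N : ℤ) ≤ |k|}, f k := rfl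
  linarith

/-- A differential inequality with positive forcing pushes a nonnegative function up linearly. -/
lemma linear_growth {u A w : ℝ → ℝ} {s e M γ : ℝ} (hγ : 0 < γ)
    (hu : ∀ t ∈ Set.Icc s e, HasDerivAt u (A t * u t + w t) t)
    (hA : ∀ t ∈ Set.Icc s e, |A t| ≤ M) (hM : M * (e - s) ≤ 1)
    (hw : ∀ t ∈ Set.Icc s e, γ ≤ w t) (hs : 0 ≤ u s) :
    ∀ t ∈ Set.Icc s e, γ / 4 * (t - s) ≤ u t := by
  intro t ht
  refine image_le_of_deriv_right_lt_deriv_boundary' (f := fun t => γ / 4 * (t - s))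
    (f' := fun _ => γ / 4) (by fun_prop) (fun x _ => ?_) (by simpa using hs)
    (fun x hx => (hu x hx).continuousAt.continuousWithinAt)
    (fun x hx => (hu x (Set.Ico_subset_Icc_self hx)).hasDerivWithinAt) (fun x hx hxu => ?_) ht
  · simpa using (((hasDerivAt_id x).sub_const s).const_mul (γ / 4)).hasDerivWithinAt
  · have hx_mem := Set.Ico_subset_Icc_self hx
    have h1 := hA x hx_mem
    have h2 := hw x hx_mem
    have h3 := neg_le_of_abs_le h1
    have h4 : 0 ≤ M := (abs_nonneg _).trans h1
    have h5 : M * (x - s) ≤ 1 := by nlinarith [hx.2]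
    rw [← hxu]
    have h6 : 0 ≤ x - s := by linarith [hx.1]
    have h7 : -(M * (γ / 4 * (x - s))) ≤ A x * (γ / 4 * (x - s)) := by
      have : 0 ≤ γ / 4 * (x - s) := by positivity
      nlinarith
    nlinarith

/-- Propagation of a lower bound along consecutive sites of a transport chain, provided each
site is nonnegative at some moment of every window on which its left neighbour is large. -/
lemma chain_propagation {α M c ρ δ τ T t₀ : ℝ} {ω p : ℤ → ℝ → ℝ} {k : ℤ} {n : ℕ}
    (hω : ∀ i, ∀ t ∈ Set.Icc t₀ (t₀ + T), HasDerivAt (ω i)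
      ((α - p i t) * ω i t + Real.exp (-α) * p (i - 1) t * ω (i - 1) t) t)
    (hM : ∀ i, ∀ t ∈ Set.Icc t₀ (t₀ + T), |α - p i t| ≤ M) (hMT : M * T ≤ 1)
    (hc : 0 < c) (hcp : ∀ i ∈ Set.Ico k (k + n), ∀ t ∈ Set.Icc t₀ (t₀ + T),
      c ≤ Real.exp (-α) * p i t)
    (hδ : 0 < δ) (hρ : 0 < ρ) (hρ1 : ρ ≤ 1) (hρc : ρ ≤ c * τ / 4) (hτ : 0 < τ)
    (hT : (2 * n + 1) * τ ≤ T)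
    (hstart : ∀ t ∈ Set.Icc t₀ (t₀ + T), δ ≤ ω k t)
    (hgood : ∀ i ∈ Set.Ico k (k + n), ∀ a, t₀ ≤ a → a + τ ≤ t₀ + T →
      (∀ t ∈ Set.Icc a (a + τ), ρ ^ n * δ ≤ ω i t) → ∃ s ∈ Set.Icc a (a + τ), 0 ≤ ω (i + 1) s) :
    ∀ j ≤ n, ∀ t ∈ Set.Icc (t₀ + 2 * j * τ) (t₀ + T), ρ ^ j * δ ≤ ω (k + j) t := by
  intro j
  induction j with
  | zero => intro _ t ht; simpa using hstart t (by simpa using ht)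
  | succ j ih =>
    intro hj t ht
    have ih := ih (by omega)
    have hjn : (j : ℝ) + 1 ≤ n := by exact_mod_cast hj
    have hmem : k + (j : ℤ) ∈ Set.Ico k (k + n) := ⟨by omega, by omega⟩
    push_cast at ht ⊢
    have hjτ : 0 ≤ 2 * (j : ℝ) * τ := by positivity
    have hjT : 2 * ((j : ℝ) + 1) * τ + τ ≤ T := by nlinarith
    obtain ⟨s, hs, hs0⟩ := hgood _ hmem (t₀ + 2 * j * τ) (by linarith) (by linarith)
      (fun t ht => by
        refine le_trans ?_ (ih t ⟨ht.1, by linarith [ht.2]⟩)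
        exact mul_le_mul_of_nonneg_right (pow_le_pow_of_le_one hρ.le hρ1 (by omega)) hδ.le)
    have hsub : Set.Icc s (t₀ + T) ⊆ Set.Icc t₀ (t₀ + T) :=
      Set.Icc_subset_Icc_left (by linarith [hs.1])
    have hM0 : 0 ≤ M := (abs_nonneg _).trans (hM 0 t (⟨by linarith [ht.1], ht.2⟩))
    have hg := linear_growth (u := ω (k + j + 1)) (s := s) (e := t₀ + T) (M := M)
      (γ := c * (ρ ^ j * δ)) (by positivity)
      (fun t ht => hω _ t (hsub ht)) (fun t ht => hM _ t (hsub ht))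
      (by nlinarith [hs.1])
      (fun t ht => by
        rw [add_sub_cancel_right]
        have h1 := hcp _ hmem t (hsub ht)
        have h2 := ih t ⟨by linarith [ht.1, hs.1], ht.2⟩
        have h3 : 0 < ρ ^ j * δ := by positivity
        exact mul_le_mul h1 h2 h3.le (hc.le.trans h1)) hs0 t ⟨by linarith [ht.1, hs.2], ht.2⟩
    rw [← add_assoc]
    refine le_trans ?_ hg
    have h1 : τ ≤ t - s := by linarith [ht.1, hs.2]
    have h2 : 0 < ρ ^ j * δ := by positivity
    calc ρ ^ (j + 1) * δ = ρ * (ρ ^ j * δ) := by ring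
      _ ≤ c * τ / 4 * (ρ ^ j * δ) := by gcongr
      _ = c * (ρ ^ j * δ) / 4 * τ := by ring
      _ ≤ _ := by gcongr

lemma psi_eq_sub {θ t : ℝ} (ht : t ∈ Set.Ioo θ (θ + 1)) : psi t θ = t - θ := by
  have : ⌊t - θ⌋ = 0 := Int.floor_eq_zero_iff.2 ⟨by linarith [ht.1], by linarith [ht.2]⟩
  simp [psi, this]

lemma psi_mem_Icc (t θ : ℝ) : psi t θ ∈ Set.Icc (0 : ℝ) 1 :=
  ⟨Int.fract_nonneg (t - θ), (Int.fract_lt_one (t - θ)).le⟩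

/-- The translated profile carries the prescribed mass on each fibre. -/
lemma phibar_hasSum {α : ℝ} (hα : 0 < α) {h : ℝ → ℝ} (href : IsRefProfile α h) {m : ℝ}
    (hm : 0 < m) (θ t : ℝ) :
    HasSum (fun k : ℤ => Real.exp (α * k) * phibar h (Real.log m / α) θ k t)
      (Real.exp (α * (psi t θ - 1)) * m) := by
  have h1 := (href.hasSum hα (1 - Real.log m / α - psi t θ)).mul_left
    (Real.exp (α * (psi t θ - 1)) * m)
  rw [mul_one] at h1
  have e : (fun k : ℤ => Real.exp (α * k) * phibar h (Real.log m / α) θ k t) = fun k : ℤ =>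
      Real.exp (α * (psi t θ - 1)) * m *
        (Real.exp (α * (1 - Real.log m / α - psi t θ + k)) *
          h (1 - Real.log m / α - psi t θ + k)) := by
    funext k
    have e1 : Real.exp (α * k) = Real.exp (α * (psi t θ - 1)) * m *
        Real.exp (α * (1 - Real.log m / α - psi t θ + k)) := by
      nth_rewrite 1 [← Real.exp_log hm]
      rw [← Real.exp_add, ← Real.exp_add]
      congr 1
      field_simp
      ring
    rw [phibar, e1, mul_assoc]
    ring_nf
  rw [e]
  exact h1

lemma phibar_hasDerivAt {α : ℝ} {h : ℝ → ℝ} (href : IsRefProfile α h) (lam : ℝ) {θ t : ℝ}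
    (k : ℤ) (ht : t ∈ Set.Ioo θ (θ + 1)) :
    HasDerivAt (phibar h lam θ k) (α * phibar h lam θ k t
      + Real.exp (-α) * phibar h lam θ (k - 1) t ^ 2 - phibar h lam θ k t ^ 2) t := by
  obtain ⟨hcd, -, -, heq, -, -⟩ := href
  have hdiff : Differentiable ℝ h := hcd.differentiable (by norm_num)
  have h1 : HasDerivAt (fun s => h ((k : ℝ) + 1 - lam - (s - θ)))
      (deriv h ((k : ℝ) + 1 - lam - (t - θ)) * (-1)) t := by
    refine HasDerivAt.comp (h₂ := h) t (hdiff _).hasDerivAt ?_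
    exact ((hasDerivAt_id t).sub_const θ).const_sub _
  have h2 : HasDerivAt (phibar h lam θ k) (deriv h ((k : ℝ) + 1 - lam - (t - θ)) * (-1)) t := by
    refine h1.congr_of_eventuallyEq ?_
    filter_upwards [Ioo_mem_nhds ht.1 ht.2] with s hs
    rw [phibar, psi_eq_sub hs]
  refine h2.congr_deriv ?_
  have e := heq ((k : ℝ) + 1 - lam - (t - θ))
  simp only [phibar, psi_eq_sub ht]
  have : ((k - 1 : ℤ) : ℝ) + 1 - lam - (t - θ) = (k : ℝ) + 1 - lam - (t - θ) - 1 := by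
    push_cast; ring
  rw [this]
  linear_combination e

/-- On finitely many sites the translated profile is bounded below. -/
lemma phibar_exists_lower_bound {α : ℝ} {h : ℝ → ℝ} (href : IsRefProfile α h) (lam θ : ℝ)
    (N : ℕ) : ∃ b > (0 : ℝ), ∀ k : ℤ, |k| ≤ N → ∀ t, b ≤ phibar h lam θ k t := by
  obtain ⟨hcd, -, -, -, ⟨C, hC, L, hL, hb⟩, -⟩ := href
  obtain ⟨x, -, hx⟩ := (isCompact_Icc (a := -(N : ℝ) - lam) (b := (N : ℝ) + 1 - lam)).exists_isMinOn
    (Set.nonempty_Icc.2 (by have : (0 : ℝ) ≤ N := N.cast_nonneg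
                            linarith)) hcd.continuous.continuousOn
  refine ⟨h x, (hb x).1, fun k hk t => ?_⟩
  have hψ := psi_mem_Icc t θ
  have hk_real : |(k : ℝ)| ≤ N := by exact_mod_cast hk
  rw [abs_le] at hk_real
  exact hx ⟨by linarith [hψ.2], by linarith [hψ.1]⟩

lemma signPlus_of_pos {r : ℝ} (h : 0 < r) : signPlus r = 1 := if_pos h

lemma signPlus_of_nonpos {r : ℝ} (h : r ≤ 0) : signPlus r = 0 := if_neg h.not_gt

lemma measurable_signPlus : Measurable signPlus :=
  Measurable.ite measurableSet_Ioi measurable_const measurable_const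

lemma mul_signPlus_sub_nonneg (r s : ℝ) : 0 ≤ r * (signPlus r - signPlus s) := by
  rcases lt_or_ge 0 r with hr | hr <;> rcases lt_or_ge 0 s with hs | hs <;>
    simp [signPlus_of_pos, signPlus_of_nonpos, hr, hs, le_of_lt]

lemma mul_signPlus_sub_le (r s : ℝ) : r * (signPlus r - signPlus s) ≤ |r| := by
  rcases lt_or_ge 0 r with hr | hr <;> rcases lt_or_ge 0 s with hs | hs <;>
    simp [signPlus_of_pos, signPlus_of_nonpos, hr, hs, le_abs_self, neg_le_abs]

/-- A bounded nonnegative function which is large on a window has a large integral. -/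
lemma mul_le_intervalIntegral_of_window {D : ℝ → ℝ} {l r a τ η B : ℝ}
    (hm : AEMeasurable D (volume.restrict (Set.Ioo l r))) (h0 : ∀ t ∈ Set.Ioo l r, 0 ≤ D t)
    (hB : ∀ t ∈ Set.Ioo l r, D t ≤ B) (hla : l < a) (hτ : 0 < τ) (har : a + τ < r)
    (hη : ∀ t ∈ Set.Icc a (a + τ), η ≤ D t) : τ * η ≤ ∫ t in l..r, D t := by
  have hrestrict : volume.restrict (Set.Ioc l r) = volume.restrict (Set.Ioo l r) :=
    (Measure.restrict_congr_set Ioo_ae_eq_Ioc).symm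
  have hint : IntervalIntegrable D volume l r := by
    rw [intervalIntegrable_iff_integrableOn_Ioo_of_le (by linarith)]
    refine Integrable.of_bound hm.aestronglyMeasurable B ?_
    filter_upwards [ae_restrict_mem measurableSet_Ioo] with t ht
    rw [Real.norm_of_nonneg (h0 t ht)]
    exact hB t ht
  have h1 : ∫ t in a..(a + τ), D t ≤ ∫ t in l..r, D t := by
    refine intervalIntegral.integral_mono_interval hla.le (by linarith) har.le ?_ hint
    rw [hrestrict]
    filter_upwards [ae_restrict_mem measurableSet_Ioo] with t ht using h0 t ht
  have h2 : ∫ _ in a..(a + τ), η ≤ ∫ t in a..(a + τ), D t := by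
    refine intervalIntegral.integral_mono_on (by linarith) (by simp) (hint.mono_set ?_) hη
    rw [Set.uIcc_of_le (by linarith), Set.uIcc_of_le (by linarith)]
    exact Set.Icc_subset_Icc hla.le har.le
  simp only [intervalIntegral.integral_const, add_sub_cancel_left, smul_eq_mul] at h2
  exact h2.trans h1

/-- A weighted sum which is large has a large entry. -/
lemma exists_le_of_le_sum {s : Finset ℤ} {w f : ℤ → ℝ} {A : ℝ} (hA : 0 < A) (hw : ∀ k, 0 ≤ w k)
    (h : A ≤ ∑ k ∈ s, w k * f k) : ∃ k ∈ s, A / (∑ k ∈ s, w k + 1) ≤ f k := by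
  by_contra! hlt
  have hS : 0 ≤ ∑ k ∈ s, w k := Finset.sum_nonneg fun k _ => hw k
  have h1 : ∑ k ∈ s, w k * f k ≤ ∑ k ∈ s, w k * (A / (∑ k ∈ s, w k + 1)) :=
    Finset.sum_le_sum fun k hk => mul_le_mul_of_nonneg_left (hlt k hk).le (hw k)
  rw [← Finset.sum_mul] at h1
  have h2 : (∑ k ∈ s, w k) * (A / (∑ k ∈ s, w k + 1)) < A := by
    rw [← mul_div_assoc, div_lt_iff₀ (by linarith)]
    nlinarith
  linarith

set_option maxHeartbeats 2000000 in
theorem dissipation_lower_bound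
    (α : ℝ) (hα : 0 < α) (hbar : ℝ → ℝ) (href : IsRefProfile α hbar)
    (θ : ℝ) (hθ : θ ∈ Set.Ico (0:ℝ) 1) (m : ℝ) (hm : 0 < m)
    (c₀ ε : ℝ) (hc₀ : 0 < c₀) (hε : 0 < ε) (N : ℕ)
    (htightbar : ∀ t : ℝ,
      ∑' k : {k : ℤ // (N : ℤ) ≤ |(k : ℤ)|},
          Real.exp (α * ((k : ℤ) : ℝ)) * phibar hbar (Real.log m / α) θ (k : ℤ) t
        ≤ 2 * Real.exp α * ε) :
    ∃ ν > (0:ℝ), ∀ q : ℤ → ℝ → ℝ,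
      (∀ k : ℤ, ∀ t ∈ Set.Ioo θ (θ + 1), 0 ≤ q k t) →
      (∀ k : ℤ, ContDiffOn ℝ 1 (q k) (Set.Ioo θ (θ + 1))) →
      (∀ k : ℤ, ∀ t ∈ Set.Ioo θ (θ + 1),
        HasDerivAt (q k)
          (α * q k t + Real.exp (-α) * (q (k - 1) t) ^ 2 - (q k t) ^ 2) t) →
      (∀ t ∈ Set.Ioo θ (θ + 1),
        ∑' k : ℤ, Real.exp (α * (k : ℝ)) * q k t = Real.exp (α * (psi t θ - 1)) * m) →
      (∀ k : ℤ, ∀ t ∈ Set.Ioo θ (θ + 1), q k t ≤ c₀) →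
      (∀ t ∈ Set.Ioo θ (θ + 1),
        ∑' k : {k : ℤ // (N : ℤ) ≤ |(k : ℤ)|},
            Real.exp (α * ((k : ℤ) : ℝ)) * q (k : ℤ) t ≤ 2 * Real.exp α * ε) →
      (∀ t ∈ Set.Ico θ (θ + 1),
        16 * Real.exp α * ε ≤
          ∑' k : ℤ, Real.exp (α * (k : ℝ)) *
            max (q k t - phibar hbar (Real.log m / α) θ k t) 0) →
      ν ≤ ∫ t in θ..(θ + 1),
        ∑' k : ℤ, Real.exp (α * (k : ℝ)) *
          (q k t + phibar hbar (Real.log m / α) θ k t) *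
          (q k t - phibar hbar (Real.log m / α) θ k t) *
          (signPlus (q k t - phibar hbar (Real.log m / α) θ k t)
            - signPlus (q (k + 1) t - phibar hbar (Real.log m / α) θ (k + 1) t)) := by
  obtain ⟨C, hC, hbC⟩ := href.exists_bound
  obtain ⟨b, hb, hbφ⟩ := phibar_exists_lower_bound href (Real.log m / α) θ N
  have hhnn := href.2.1
  set φ := phibar hbar (Real.log m / α) θ with hφ
  have hφ0 : ∀ k t, 0 ≤ φ k t := fun k t => hhnn _
  have hφC : ∀ k t, φ k t ≤ C := fun k t => hbC _
  set W : ℝ := c₀ + C with hW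
  have hW0 : 0 < W := by positivity
  set M : ℝ := α + W with hMdef
  have hM0 : 0 < M := by positivity
  set K : ℝ := M * W + W * W with hK
  have hK0 : 0 < K := by positivity
  set S : ℝ := ∑ k ∈ Finset.Ioo (-(N : ℤ)) N, Real.exp (α * (k : ℝ)) with hS
  have hS0 : 0 ≤ S := Finset.sum_nonneg fun k _ => Real.exp_nonneg _
  set δ : ℝ := 14 * Real.exp α * ε / (S + 1) with hδdef
  have hδ : 0 < δ := by positivity
  set T : ℝ := 1 / (4 + M + 2 * K / δ) with hTdef
  have hT0 : 0 < T := by positivity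
  have hTeq : T * (4 + M + 2 * K / δ) = 1 := by rw [hTdef]; field_simp
  have hKδ : 0 < 2 * K / δ := by positivity
  have hT4 : T ≤ 1 / 4 := by nlinarith
  have hMT : M * T ≤ 1 := by nlinarith
  have hKT : K * T ≤ δ / 2 := by
    have h1 : T * (2 * K / δ) ≤ 1 := by nlinarith
    rw [← mul_div_assoc, div_le_one hδ] at h1
    linarith
  set τ : ℝ := T / (4 * N + 1) with hτdef
  have hτ : 0 < τ := by positivity
  have hτT : (4 * N + 1) * τ = T := by rw [hτdef]; field_simp
  set c : ℝ := Real.exp (-α) * b with hcdef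
  have hc : 0 < c := by positivity
  set ρ : ℝ := min 1 (c * τ / 4) with hρdef
  have hρ : 0 < ρ := lt_min one_pos (by positivity)
  have hρ1 : ρ ≤ 1 := min_le_left _ _
  have hρc : ρ ≤ c * τ / 4 := min_le_right _ _
  set η : ℝ := Real.exp (-α * N) * b * (ρ ^ (2 * N) * (δ / 2)) with hηdef
  have hη : 0 < η := by positivity
  clear_value T τ ρ η K M c
  refine ⟨τ * η, by positivity, ?_⟩
  intro q hq0 _ hqd hqm hqc hqtail hpos
  have hIcc : ∀ t ∈ Set.Icc (θ + 1 / 2) (θ + 1 / 2 + T), t ∈ Set.Ioo θ (θ + 1) := fun t ht =>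
    ⟨by linarith [ht.1], by linarith [ht.2]⟩
  set ω : ℤ → ℝ → ℝ := fun k t => q k t - φ k t with hω
  set p : ℤ → ℝ → ℝ := fun k t => q k t + φ k t with hp
  have hp0 : ∀ k, ∀ t ∈ Set.Ioo θ (θ + 1), 0 ≤ p k t := fun k t ht =>
    add_nonneg (hq0 k t ht) (hφ0 k t)
  have hpW : ∀ k, ∀ t ∈ Set.Ioo θ (θ + 1), p k t ≤ W := fun k t ht =>
    add_le_add (hqc k t ht) (hφC k t)
  have hωp : ∀ k, ∀ t ∈ Set.Ioo θ (θ + 1), |ω k t| ≤ p k t := fun k t ht => by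
    have h1 := hq0 k t ht
    have h2 := hφ0 k t
    exact abs_le.2 ⟨by simp only [hω, hp]; linarith, by simp only [hω, hp]; linarith⟩
  have hωd : ∀ k, ∀ t ∈ Set.Ioo θ (θ + 1), HasDerivAt (ω k)
      ((α - p k t) * ω k t + Real.exp (-α) * p (k - 1) t * ω (k - 1) t) t := fun k t ht => by
    refine ((hqd k t ht).sub (phibar_hasDerivAt href _ k ht)).congr_deriv ?_
    simp only [hω, hp, ← hφ]
    ring
  have hMp : ∀ k, ∀ t ∈ Set.Ioo θ (θ + 1), |α - p k t| ≤ M := fun k t ht => by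
    have h1 := hp0 k t ht
    have h2 := hpW k t ht
    exact abs_le.2 ⟨by linarith, by linarith⟩
  have hexp1 : Real.exp (-α) ≤ 1 := Real.exp_le_one_iff.2 (by linarith)
  have hωLip : ∀ k, ∀ t ∈ Set.Icc (θ + 1 / 2) (θ + 1 / 2 + T),
      |ω k t - ω k (θ + 1 / 2)| ≤ δ / 2 := fun k t ht => by
    have h1 := (convex_Icc (θ + 1 / 2) (θ + 1 / 2 + T)).norm_image_sub_le_of_norm_hasDerivWithin_le
      (C := K) (fun x hx => (hωd k x (hIcc x hx)).hasDerivWithinAt) (fun x hx => by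
        have hx := hIcc x hx
        have e1 : |(α - p k x) * ω k x| ≤ M * W := by
          rw [abs_mul]
          exact mul_le_mul (hMp k x hx) ((hωp k x hx).trans (hpW k x hx)) (abs_nonneg _) hM0.le
        have e2 : |Real.exp (-α) * p (k - 1) x * ω (k - 1) x| ≤ W * W := by
          rw [abs_mul, abs_mul, abs_of_pos (Real.exp_pos _), abs_of_nonneg (hp0 _ x hx)]
          refine mul_le_mul ?_ ((hωp _ x hx).trans (hpW _ x hx)) (abs_nonneg _) hW0.le
          have := hpW (k - 1) x hx
          have := hp0 (k - 1) x hx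
          nlinarith [Real.exp_pos (-α)]
        exact (norm_add_le _ _).trans (hK ▸ add_le_add e1 e2))
      (Set.left_mem_Icc.2 (by linarith)) ht
    rw [Real.norm_eq_abs, Real.norm_eq_abs,
      abs_of_nonneg (show (0 : ℝ) ≤ t - (θ + 1 / 2) by linarith [ht.1])] at h1
    have : K * (t - (θ + 1 / 2)) ≤ K * T := by
      have := ht.2
      gcongr
      linarith
    linarith
  have hpb : ∀ k : ℤ, |k| ≤ N → ∀ t ∈ Set.Ioo θ (θ + 1), b ≤ p k t := fun k hk t ht => by
    have h1 := hbφ k hk t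
    have h2 := hq0 k t ht
    simp only [hp]
    linarith
  -- summability
  have hφsum : ∀ t, HasSum (fun k : ℤ => Real.exp (α * (k : ℝ)) * φ k t)
      (Real.exp (α * (psi t θ - 1)) * m) := fun t => phibar_hasSum hα href hm θ t
  have hqsum : ∀ t ∈ Set.Ioo θ (θ + 1), HasSum (fun k : ℤ => Real.exp (α * (k : ℝ)) * q k t)
      (Real.exp (α * (psi t θ - 1)) * m) := fun t ht => by
    have hs : Summable fun k : ℤ => Real.exp (α * (k : ℝ)) * q k t := by
      by_contra hns
      have h1 := hqm t ht
      rw [tsum_eq_zero_of_not_summable hns] at h1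
      have : 0 < Real.exp (α * (psi t θ - 1)) * m := by positivity
      linarith
    rw [← hqm t ht]
    exact hs.hasSum
  have hmass : ∀ t, Real.exp (α * (psi t θ - 1)) * m ≤ m := fun t => by
    have : Real.exp (α * (psi t θ - 1)) ≤ 1 :=
      Real.exp_le_one_iff.2 (by nlinarith [(psi_mem_Icc t θ).2])
    nlinarith
  have hpsum : ∀ t ∈ Set.Ioo θ (θ + 1), HasSum (fun k : ℤ => Real.exp (α * (k : ℝ)) * p k t)
      (Real.exp (α * (psi t θ - 1)) * m + Real.exp (α * (psi t θ - 1)) * m) := fun t ht => by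
    simp only [hp, mul_add]
    exact (hqsum t ht).add (hφsum t)
  -- the dissipation density
  set d : ℤ → ℝ → ℝ := fun k t => Real.exp (α * (k : ℝ)) * p k t * ω k t *
    (signPlus (ω k t) - signPlus (ω (k + 1) t)) with hd
  change τ * η ≤ ∫ t in θ..(θ + 1), ∑' k : ℤ, d k t
  have hd0 : ∀ k, ∀ t ∈ Set.Ioo θ (θ + 1), 0 ≤ d k t := fun k t ht => by
    have h1 := hp0 k t ht
    simp only [hd]
    rw [mul_assoc]
    exact mul_nonneg (by positivity) (mul_signPlus_sub_nonneg _ _)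
  have hdle : ∀ k, ∀ t ∈ Set.Ioo θ (θ + 1), d k t ≤ Real.exp (α * (k : ℝ)) * p k t * W :=
    fun k t ht => by
    have h1 := hp0 k t ht
    simp only [hd]
    rw [mul_assoc (Real.exp (α * (k : ℝ)) * p k t)]
    exact mul_le_mul_of_nonneg_left ((mul_signPlus_sub_le _ _).trans
      ((hωp k t ht).trans (hpW k t ht))) (by positivity)
  have hdsum : ∀ t ∈ Set.Ioo θ (θ + 1), Summable fun k => d k t := fun t ht =>
    Summable.of_nonneg_of_le (fun k => hd0 k t ht) (fun k => hdle k t ht)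
      ((hpsum t ht).summable.mul_right W)
  have hD0 : ∀ t ∈ Set.Ioo θ (θ + 1), 0 ≤ ∑' k, d k t := fun t ht =>
    tsum_nonneg fun k => hd0 k t ht
  have hDB : ∀ t ∈ Set.Ioo θ (θ + 1), ∑' k, d k t ≤ (m + m) * W := fun t ht => by
    have h1 := (hpsum t ht).mul_right W
    refine ((hdsum t ht).tsum_le_tsum (fun k => hdle k t ht) h1.summable).trans ?_
    rw [h1.tsum_eq]
    have := hmass t
    gcongr
  have hDm : AEMeasurable (fun t => ∑' k, d k t) (volume.restrict (Set.Ioo θ (θ + 1))) := by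
    have hqmeas : ∀ k, AEMeasurable (q k) (volume.restrict (Set.Ioo θ (θ + 1))) := fun k =>
      ContinuousOn.aemeasurable
        (fun t ht => (hqd k t ht).continuousAt.continuousWithinAt) measurableSet_Ioo
    have hφm : ∀ k, AEMeasurable (φ k) (volume.restrict (Set.Ioo θ (θ + 1))) := fun k =>
      ContinuousOn.aemeasurable
        (fun t ht => (phibar_hasDerivAt href _ k ht).continuousAt.continuousWithinAt)
        measurableSet_Ioo
    have hωm : ∀ k, AEMeasurable (ω k) (volume.restrict (Set.Ioo θ (θ + 1))) := fun k =>
      (hqmeas k).sub (hφm k)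
    refine AEMeasurable.tsum fun k => ?_
    exact ((((hqmeas k).add (hφm k)).const_mul _).mul (hωm k)).mul
      ((measurable_signPlus.comp_aemeasurable (hωm k)).sub
        (measurable_signPlus.comp_aemeasurable (hωm (k + 1))))
  have hwindow : ∀ k : ℤ, ∀ a, θ + 1 / 2 ≤ a → a + τ ≤ θ + 1 / 2 + T →
      (∀ t ∈ Set.Icc a (a + τ), η ≤ d k t) → τ * η ≤ ∫ t in θ..(θ + 1), ∑' k, d k t := by
    intro k a ha haτ hk
    refine mul_le_intervalIntegral_of_window hDm hD0 hDB (by linarith) hτ (by linarith)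
      fun t ht => (hk t ht).trans ?_
    have ht_mem := hIcc t ⟨by linarith [ht.1], by linarith [ht.2]⟩
    exact (hdsum t ht_mem).le_tsum k fun j _ => hd0 j t ht_mem
  by_contra hlt
  have hdη : ∀ k : ℤ, |k| ≤ N → ∀ t ∈ Set.Ioo θ (θ + 1), ∀ n : ℕ, n ≤ 2 * N →
      ρ ^ n * (δ / 2) ≤ ω k t * (signPlus (ω k t) - signPlus (ω (k + 1) t)) → η ≤ d k t := by
    intro k hk t ht n hn h
    have h1 : ρ ^ (2 * N) * (δ / 2) ≤ ρ ^ n * (δ / 2) := by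
      have := pow_le_pow_of_le_one hρ.le hρ1 hn
      gcongr
    have h2 : Real.exp (-α * N) ≤ Real.exp (α * (k : ℝ)) := by
      have hk_real : |(k : ℝ)| ≤ N := by exact_mod_cast hk
      rw [abs_le] at hk_real
      apply Real.exp_le_exp.2
      nlinarith
    have h3 := hpb k hk t ht
    simp only [hd]
    rw [mul_assoc (Real.exp (α * (k : ℝ)) * p k t), hηdef]
    refine mul_le_mul (mul_le_mul h2 h3 hb.le (Real.exp_nonneg _)) (h1.trans h) (by positivity) ?_
    exact mul_nonneg (Real.exp_nonneg _) (hp0 k t ht)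
  -- large positive and negative entries at the initial time
  have ht₀ : θ + 1 / 2 ∈ Set.Ioo θ (θ + 1) := ⟨by linarith, by linarith⟩
  have hA : 0 < 14 * Real.exp α * ε := by positivity
  have hentry : ∀ f g : ℤ → ℝ, (∀ k, 0 ≤ f k) → (∀ k, f k ≤ g k) →
      Summable (fun k : ℤ => Real.exp (α * (k : ℝ)) * g k) →
      ∑' k : {k : ℤ // (N : ℤ) ≤ |(k : ℤ)|}, Real.exp (α * ((k : ℤ) : ℝ)) * g k
        ≤ 2 * Real.exp α * ε →
      16 * Real.exp α * ε ≤ ∑' k : ℤ, Real.exp (α * (k : ℝ)) * f k →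
      ∃ k ∈ Finset.Ioo (-(N : ℤ)) N, δ ≤ f k := by
    intro f g hf hfg hg htail hlarge
    refine exists_le_of_le_sum hA (fun k : ℤ => Real.exp_nonneg (α * (k : ℝ))) ?_
    have h1 := sum_Ioo_ge_of_tail_le N
      (f := fun k : ℤ => Real.exp (α * (k : ℝ)) * f k)
      (g := fun k : ℤ => Real.exp (α * (k : ℝ)) * g k)
      (fun k => mul_nonneg (Real.exp_nonneg _) (hf k))
      (fun k => mul_le_mul_of_nonneg_left (hfg k) (Real.exp_nonneg _)) hg htail hlarge
    linarith
  have hposum := hpos (θ + 1 / 2) ⟨by linarith, by linarith⟩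
  obtain ⟨k, hk, hkδ⟩ := hentry (fun k => max (ω k (θ + 1 / 2)) 0) (fun k => q k (θ + 1 / 2))
    (fun k => le_max_right _ _)
    (fun k => max_le (by have := hφ0 k (θ + 1 / 2); simp only [hω]; linarith) (hq0 k _ ht₀))
    (hqsum _ ht₀).summable (hqtail _ ht₀) hposum
  have hnegsum : 16 * Real.exp α * ε ≤
      ∑' k : ℤ, Real.exp (α * (k : ℝ)) * max (-ω k (θ + 1 / 2)) 0 := by
    have hs : Summable fun k : ℤ => Real.exp (α * (k : ℝ)) * max (ω k (θ + 1 / 2)) 0 :=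
      Summable.of_nonneg_of_le (fun k => by positivity)
        (fun k => mul_le_mul_of_nonneg_left
          (max_le (by have := hφ0 k (θ + 1 / 2); simp only [hω]; linarith) (hq0 k _ ht₀))
          (Real.exp_nonneg _)) (hqsum _ ht₀).summable
    have h1 := (hs.hasSum.add (hφsum (θ + 1 / 2))).sub (hqsum _ ht₀)
    have e : (fun k : ℤ => Real.exp (α * (k : ℝ)) * max (-ω k (θ + 1 / 2)) 0) = fun k : ℤ =>
        Real.exp (α * (k : ℝ)) * max (ω k (θ + 1 / 2)) 0
          + Real.exp (α * (k : ℝ)) * φ k (θ + 1 / 2)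
          - Real.exp (α * (k : ℝ)) * q k (θ + 1 / 2) := by
      funext k
      have : max (-ω k (θ + 1 / 2)) 0 = max (ω k (θ + 1 / 2)) 0 - ω k (θ + 1 / 2) := by
        rcases le_total 0 (ω k (θ + 1 / 2)) with h | h
        · rw [max_eq_right (by linarith), max_eq_left h]; ring
        · rw [max_eq_left (by linarith), max_eq_right h]; ring
      rw [this]
      simp only [hω]
      ring
    rw [e, h1.tsum_eq]
    rw [add_sub_cancel_right]
    exact hposum
  obtain ⟨j, hj, hjδ⟩ := hentry (fun k => max (-ω k (θ + 1 / 2)) 0) (fun k => φ k (θ + 1 / 2))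
    (fun k => le_max_right _ _)
    (fun k => max_le (by have := hq0 k _ ht₀; simp only [hω]; linarith) (hφ0 k _))
    (hφsum _).summable (htightbar _) hnegsum
  have hkδ : δ ≤ ω k (θ + 1 / 2) := (le_max_iff.1 hkδ).resolve_right hδ.not_ge
  have hjδ : δ ≤ -ω j (θ + 1 / 2) := (le_max_iff.1 hjδ).resolve_right hδ.not_ge
  have hkT : ∀ t ∈ Set.Icc (θ + 1 / 2) (θ + 1 / 2 + T), δ / 2 ≤ ω k t := fun t ht => by
    have := (abs_le.1 (hωLip k t ht)).1
    linarith
  have hjT : ∀ t ∈ Set.Icc (θ + 1 / 2) (θ + 1 / 2 + T), δ / 2 ≤ -ω j t := fun t ht => by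
    have := (abs_le.1 (hωLip j t ht)).2
    linarith
  rw [Finset.mem_Ioo] at hk hj
  have hcp : ∀ i : ℤ, |i| ≤ N → ∀ t ∈ Set.Icc (θ + 1 / 2) (θ + 1 / 2 + T),
      c ≤ Real.exp (-α) * p i t := fun i hi t ht =>
    hcdef.trans_le <| mul_le_mul_of_nonneg_left (hpb i hi t (hIcc t ht)) (Real.exp_nonneg _)
  have htime : ∀ n : ℕ, n ≤ 2 * N → (2 * n + 1) * τ ≤ T := fun n hn => by
    have : (n : ℝ) ≤ 2 * N := by exact_mod_cast hn
    rw [← hτT]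
    exact mul_le_mul_of_nonneg_right (by linarith) hτ.le
  have hend : θ + 1 / 2 + T ∈ Set.Icc (θ + 1 / 2) (θ + 1 / 2 + T) := ⟨by linarith, le_rfl⟩
  rcases le_total k j with hkj | hjk
  · obtain ⟨n, rfl⟩ := Int.le.dest hkj
    have hn : n ≤ 2 * N := by omega
    have h1 := chain_propagation (n := n) (fun i t ht => hωd i t (hIcc t ht))
      (fun i t ht => hMp i t (hIcc t ht)) hMT hc
      (fun i hi => hcp i (abs_le.2 ⟨by linarith [hi.1], by linarith [hi.2]⟩))
      (half_pos hδ) hρ hρ1 hρc hτ (htime n hn) hkT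
      (fun i hi a ha haτ hbig => by
        by_contra! hneg
        refine hlt (hwindow i a ha haτ fun t ht => ?_)
        refine hdη i (abs_le.2 ⟨by linarith [hi.1], by linarith [hi.2]⟩) t
          (hIcc t ⟨by linarith [ht.1], by linarith [ht.2]⟩) n hn ?_
        have h2 := hbig t ht
        have h3 : 0 < ρ ^ n * (δ / 2) := by positivity
        rw [signPlus_of_pos (h3.trans_le h2), signPlus_of_nonpos (hneg t ht).le]
        linarith)
      n le_rfl (θ + 1 / 2 + T) ⟨by nlinarith [htime n hn], le_rfl⟩
    have h2 := hjT _ hend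
    have h3 : 0 < ρ ^ n * (δ / 2) := by positivity
    linarith
  · obtain ⟨n, rfl⟩ := Int.le.dest hjk
    have hn : n ≤ 2 * N := by omega
    have h1 := chain_propagation (ω := fun i t => -ω i t) (n := n)
      (fun i t ht => (hωd i t (hIcc t ht)).neg.congr_deriv (by ring))
      (fun i t ht => hMp i t (hIcc t ht)) hMT hc
      (fun i hi => hcp i (abs_le.2 ⟨by linarith [hi.1], by linarith [hi.2]⟩))
      (half_pos hδ) hρ hρ1 hρc hτ (htime n hn) hjT
      (fun i hi a ha haτ hbig => by
        by_contra! hneg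
        refine hlt (hwindow i a ha haτ fun t ht => ?_)
        refine hdη i (abs_le.2 ⟨by linarith [hi.1], by linarith [hi.2]⟩) t
          (hIcc t ⟨by linarith [ht.1], by linarith [ht.2]⟩) n hn ?_
        have h2 := hbig t ht
        have h3 : 0 < ρ ^ n * (δ / 2) := by positivity
        rw [signPlus_of_nonpos (by linarith), signPlus_of_pos (by linarith [hneg t ht])]
        linarith)
      n le_rfl (θ + 1 / 2 + T) ⟨by nlinarith [htime n hn], le_rfl⟩
    have h2 := hkT _ hend
    have h3 : 0 < ρ ^ n * (δ / 2) := by positivity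
    linarith
end
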